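/- arXiv:2603.15316 — 3 statements merged into one kernel-verified Lean document; each statement's English description precedes it below -/
import Mathlib

section
/- Let n,m ≥ 1 and let k ≥ 3 be an integer, and let α = (k,0,…,0), so that X^α = ∂^k_{x'_1}. Then the Riesz transform R_{α,e_1} = ∂^k_{x'_1} G_{e_1}^{−k/2} is not of weak type (1,1) with respect to dμ_{e_1}: there is no constant C such that μ_{e_1}({x ∈ ℝ^{n+m} : |R_{α,e_1}f(x)| > s}) ≤ C s^{−1} ‖f‖_{L^1(ℝ^{n+m}, dμ_{e_1})} for all f ∈ C_c^∞(ℝ^{n+m}) and all s > 0. In particular, for every k ≥ 3, not all Riesz transforms of order k are of weak type (1,1) with respect to dμ_{e_1}. -/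
noncomputable section
open MeasureTheory Real Set Filter

/-- `ℝ^{n+m}` written as pairs `x = (x', x'')`. -/
abbrev Ep (n m : ℕ) := EuclideanSpace ℝ (Fin n) × EuclideanSpace ℝ (Fin m)

/-- Euclidean dot product. -/
def dotp {n : ℕ} (a b : EuclideanSpace ℝ (Fin n)) : ℝ := ∑ i, a i * b i

/-- The measure `dμ_a = e^{2a·x'} dx` on `ℝ^{n+m}`. -/
def muG {n m : ℕ} (a : EuclideanSpace ℝ (Fin n)) : Measure (Ep n m) :=
  volume.withDensity fun x => ENNReal.ofReal (Real.exp (2 * dotp a x.1))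

/-- Scaled Hermite heat kernel `k_{t,λ}(x',y')`. -/
def hermiteK (n : ℕ) {m : ℕ} (t : ℝ) (lam : EuclideanSpace ℝ (Fin m))
    (x' y' : EuclideanSpace ℝ (Fin n)) : ℝ :=
  (‖lam‖ / (2 * π * Real.sinh (2 * ‖lam‖ * t))) ^ ((n : ℝ) / 2) *
    Real.exp (-(‖lam‖ / 2) * (Real.cosh (2 * ‖lam‖ * t) / Real.sinh (2 * ‖lam‖ * t)) *
        ‖x' - y'‖ ^ 2 - ‖lam‖ * Real.tanh (‖lam‖ * t) * dotp x' y')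

/-- Grushin heat kernel `H_t(x,y) = (2π)^{-m} ∫ k_{t,λ}(x',y') e^{-iλ·(x''-y'')} dλ`. -/
def grushinH {n m : ℕ} (t : ℝ) (x y : Ep n m) : ℂ :=
  ((((2 * π) ^ m)⁻¹ : ℝ) : ℂ) * ∫ lam : EuclideanSpace ℝ (Fin m),
    ((hermiteK n t lam x.1 y.1 : ℝ) : ℂ) *
      Complex.exp (-Complex.I * ((dotp lam (x.2 - y.2) : ℝ) : ℂ))

/-- Drifted Grushin heat kernel `H_{t,a}(x,y) = e^{-|a|²t} e^{-a·(x'+y')} H_t(x,y)`. -/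
def driftH {n m : ℕ} (a : EuclideanSpace ℝ (Fin n)) (t : ℝ) (x y : Ep n m) : ℂ :=
  ((Real.exp (-‖a‖ ^ 2 * t) * Real.exp (-dotp a (x.1 + y.1)) : ℝ) : ℂ) * grushinH t x y

/-- The drifted heat semigroup `e^{-tG_a} f(x) = ∫ H_{t,a}(x,y) f(y) e^{2a·y'} dy`. -/
def heatOp {n m : ℕ} (a : EuclideanSpace ℝ (Fin n)) (t : ℝ) (f : Ep n m → ℂ)
    (x : Ep n m) : ℂ :=
  ∫ y : Ep n m, driftH a t x y * f y * ((Real.exp (2 * dotp a y.1) : ℝ) : ℂ)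

/-- The partial derivative `∂_{x'_1}` (in the first `x'`-coordinate). -/
def pdx1 {n m : ℕ} (i : Fin n) (f : Ep n m → ℂ) (x : Ep n m) : ℂ :=
  deriv (fun s : ℝ => f (x.1 + s • EuclideanSpace.single i 1, x.2)) 0

/-- The Riesz transform `∂^k_{x'_1} (G_a)^{-k/2} f(x)
= Γ(k/2)⁻¹ ∫₀^∞ t^{k/2-1} ∂^k_{x'_1} (e^{-tG_a} f)(x) dt` (for `α = (k,0,…,0)`). -/
def rieszPd1 {n m : ℕ} (a : EuclideanSpace ℝ (Fin n)) (i : Fin n) (k : ℕ)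
    (f : Ep n m → ℂ) (x : Ep n m) : ℂ :=
  ((Real.Gamma ((k : ℝ) / 2))⁻¹ : ℝ) *
    ∫ t in Set.Ioi (0 : ℝ),
      ((t ^ (((k : ℝ) / 2) - 1) : ℝ) : ℂ) * (pdx1 i)^[k] (heatOp a t f) x


/-! ### Elementary facts -/

/-- Hermite-type polynomials: `Q_{j+2} = L Q_{j+1} - 2A(j+1) Q_j`. -/
def qP : ℕ → ℝ → ℝ → ℝ
  | 0, _, _ => 1
  | 1, _, L => L
  | (j + 2), A, L => L * qP (j + 1) A L - 2 * A * ((j : ℝ) + 1) * qP j A L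

theorem qP_continuous (j : ℕ) : Continuous fun z : ℝ × ℝ => qP j z.1 z.2 := by
  induction j using Nat.twoStepInduction with
  | zero => simp only [qP]; fun_prop
  | one => simp only [qP]; fun_prop
  | more j h1 h2 => simp only [qP]; fun_prop

theorem qP_deriv (A : ℝ) (j : ℕ) : ∀ L : ℝ,
    HasDerivAt (fun L => qP (j + 1) A L) (((j : ℝ) + 1) * qP j A L) L := by
  induction j using Nat.twoStepInduction with
  | zero => intro L; simpa [qP] using hasDerivAt_id' L
  | one =>
    intro L
    have h1 : HasDerivAt (fun L : ℝ => L * L - 2 * A * (((0 : ℕ) : ℝ) + 1) * 1)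
      (1 * L + L * 1) L := ((hasDerivAt_id L).mul (hasDerivAt_id L)).sub_const _
    refine h1.congr_deriv ?_
    simp [qP]; ring
  | more j h1 h2 =>
    intro L
    have h3 := ((hasDerivAt_id L).mul (h2 L)).sub ((h1 L).const_mul (2 * A * (((j + 1 : ℕ) : ℝ) + 1)))
    refine h3.congr_deriv ?_
    simp only [qP, id]
    push_cast
    ring

theorem qP_deriv_exp (A : ℝ) (j : ℕ) (L φ : ℝ → ℝ) (s : ℝ) (hL : HasDerivAt L (2 * A) s)
    (hφ : HasDerivAt φ (-(L s) * φ s) s) :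
    HasDerivAt (fun s => (-1) ^ j * (qP j A (L s) * φ s))
      ((-1) ^ (j + 1) * (qP (j + 1) A (L s) * φ s)) s := by
  cases j with
  | zero =>
    simp only [qP, pow_zero, one_mul, zero_add, pow_one]
    exact hφ.congr_deriv (by ring)
  | succ j =>
    have h1 := (qP_deriv A j (L s)).comp s hL
    have h2 := (h1.mul hφ).const_mul ((-1 : ℝ) ^ (j + 1))
    refine h2.congr_deriv ?_
    simp only [qP, Function.comp_apply]
    ring

theorem qP_bound (j : ℕ) : ∃ c : ℝ, 0 ≤ c ∧ ∀ A L : ℝ, 0 ≤ A →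
    |qP j A L| ≤ c * (1 + A + |L|) ^ j := by
  induction j using Nat.twoStepInduction with
  | zero => exact ⟨1, by norm_num, fun A L _ => by simp [qP]⟩
  | one => exact ⟨1, by norm_num, fun A L hA => by simp only [qP, pow_one]; linarith⟩
  | more j h1 h2 =>
    obtain ⟨c1, hc1, h1⟩ := h1
    obtain ⟨c2, hc2, h2⟩ := h2
    refine ⟨c2 + 2 * (j + 1) * c1, by positivity, fun A L hA => ?_⟩
    have hL := abs_nonneg L
    set D := 1 + A + |L| with hD
    have hD1 : 1 ≤ D := by linarith
    simp only [qP]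
    have e1 : |L * qP (j + 1) A L| ≤ D * (c2 * D ^ (j + 1)) := by
      rw [abs_mul]
      exact mul_le_mul (by linarith) (h2 A L hA) (abs_nonneg _) (by linarith)
    have e2 : |2 * A * ((j : ℝ) + 1) * qP j A L| ≤ 2 * D ^ 2 * (j + 1) * (c1 * D ^ j) := by
      rw [abs_mul, abs_of_nonneg (by positivity)]
      refine mul_le_mul ?_ (h1 A L hA) (abs_nonneg _) (by positivity)
      have : A ≤ D ^ 2 := by nlinarith
      gcongr
    calc _ ≤ _ := abs_sub _ _
      _ ≤ _ := add_le_add e1 e2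
      _ = _ := by ring

theorem qP_lower (A L : ℝ) (hL : 0 < L) (hA : 0 ≤ A) (k : ℕ) (h : 8 * A * k ≤ L ^ 2) :
    ∀ j ≤ k, 0 < qP j A L ∧ (0 < j → L / 2 * qP (j - 1) A L ≤ qP j A L) := by
  intro j
  induction j with
  | zero => intro _; simp [qP]
  | succ j ih =>
    intro hj
    obtain ⟨i1, i2⟩ := ih (by omega)
    have key : L / 2 * qP j A L ≤ qP (j + 1) A L := by
      cases j with
      | zero => simp [qP]; linarith
      | succ j =>
        have i2 := i2 (by omega)
        simp only [Nat.add_sub_cancel] at i2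
        simp only [qP]
        have hjk : ((j : ℝ) + 1) ≤ k := by exact_mod_cast (by omega : j + 1 ≤ k)
        have h3 : 8 * A * ((j : ℝ) + 1) ≤ L ^ 2 :=
          le_trans (mul_le_mul_of_nonneg_left hjk (by positivity)) h
        have h4 : qP j A L ≤ 2 / L * qP (j + 1) A L := by
          rw [div_mul_eq_mul_div, le_div_iff₀ hL]; linarith
        have h5 : 2 * A * ((j : ℝ) + 1) * qP j A L ≤ 2 * A * ((j : ℝ) + 1) * (2 / L * qP (j + 1) A L) :=
          mul_le_mul_of_nonneg_left h4 (by positivity)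
        have h6 : 2 * A * ((j : ℝ) + 1) * (2 / L * qP (j + 1) A L) ≤ L / 2 * qP (j + 1) A L := by
          have : 2 * A * ((j : ℝ) + 1) * (2 / L) ≤ L / 2 := by
            rw [mul_div_assoc', div_le_iff₀ hL]; nlinarith
          calc _ = 2 * A * ((j : ℝ) + 1) * (2 / L) * qP (j + 1) A L := by ring
            _ ≤ _ := mul_le_mul_of_nonneg_right this i1.le
        linarith
    refine ⟨lt_of_lt_of_le (by positivity) key, fun _ => by simpa using key⟩

theorem qP_lower_pow (A L : ℝ) (hL : 0 < L) (hA : 0 ≤ A) (k : ℕ) (h : 8 * A * k ≤ L ^ 2) :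
    (L / 2) ^ k ≤ qP k A L := by
  have : ∀ j ≤ k, (L / 2) ^ j ≤ qP j A L := by
    intro j
    induction j with
    | zero => intro _; simp [qP]
    | succ j ih =>
      intro hj
      have h1 := (qP_lower A L hL hA k h (j + 1) hj).2 (by omega)
      simp only [Nat.add_sub_cancel] at h1
      calc (L / 2) ^ (j + 1) = L / 2 * (L / 2) ^ j := by ring
        _ ≤ L / 2 * qP j A L := mul_le_mul_of_nonneg_left (ih (by omega)) (by positivity)
        _ ≤ _ := h1
  exact this k le_rfl

/-- coefficients -/
def cA (t l : ℝ) : ℝ := l / 2 * (cosh (2 * l * t) / sinh (2 * l * t))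
def cB (t l : ℝ) : ℝ := l * tanh (l * t)
def cP (n : ℕ) (t l : ℝ) : ℝ := (l / (2 * π * sinh (2 * l * t))) ^ ((n : ℝ) / 2)

theorem cP_base_nonneg {t l : ℝ} (ht : 0 < t) (hl : 0 ≤ l) : 0 ≤ l / (2 * π * sinh (2 * l * t)) := by
  have : 0 ≤ sinh (2 * l * t) := sinh_nonneg_iff.2 (by positivity)
  positivity

theorem cP_nonneg (n : ℕ) {t l : ℝ} (ht : 0 < t) (hl : 0 ≤ l) : 0 ≤ cP n t l :=
  rpow_nonneg (cP_base_nonneg ht hl) _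

theorem cP_zero (n : ℕ) (hn : 0 < n) (t : ℝ) : cP n t 0 = 0 := by
  simp only [cP, zero_div]
  exact zero_rpow (by positivity)

theorem cP_le (n : ℕ) {t l : ℝ} (ht : 0 < t) (hl : 0 ≤ l) :
    cP n t l ≤ (1 / (4 * π * t)) ^ ((n : ℝ) / 2) := by
  refine rpow_le_rpow (cP_base_nonneg ht hl) ?_ (by positivity)
  rcases hl.eq_or_lt with rfl | hl
  · simp; positivity
  have h : 2 * l * t ≤ sinh (2 * l * t) := self_le_sinh_iff.2 (by positivity)
  have hs : 0 < sinh (2 * l * t) := sinh_pos_iff.2 (by positivity)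
  rw [div_le_div_iff₀ (by positivity) (by positivity)]
  have := pi_pos
  nlinarith

theorem cP_le_exp (n : ℕ) {t l : ℝ} (ht : 0 < t) (hl : 0 ≤ l) :
    cP n t l ≤ (1 / (2 * π * t)) ^ ((n : ℝ) / 2) * exp (-(t * (n / 2)) * l) := by
  have : exp (-(t * (n / 2)) * l) = (exp (-(t * l))) ^ ((n : ℝ) / 2) := by
    rw [← exp_mul]; ring_nf
  rw [this, ← mul_rpow (by positivity) (by positivity)]
  refine rpow_le_rpow (cP_base_nonneg ht hl) ?_ (by positivity)
  rcases hl.eq_or_lt with rfl | hl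
  · simp; positivity
  have h1 : l * t ≤ sinh (l * t) := self_le_sinh_iff.2 (by positivity)
  have h2 : exp (t * l) / 2 ≤ cosh (l * t) := by
    rw [cosh_eq, mul_comm t l]; have := exp_pos (-(l * t)); linarith
  have h3 : l * t * exp (t * l) ≤ sinh (2 * l * t) := by
    rw [mul_assoc 2, sinh_two_mul]
    have : l * t * (exp (t * l) / 2) ≤ sinh (l * t) * cosh (l * t) :=
      mul_le_mul h1 h2 (by positivity) (by positivity)
    linarith
  have hs : 0 < sinh (2 * l * t) := sinh_pos_iff.2 (by positivity)
  rw [exp_neg, one_div, ← mul_inv, ← one_div, div_le_div_iff₀ (by positivity) (by positivity)]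
  have := pi_pos
  nlinarith

theorem cA_nonneg {t l : ℝ} (ht : 0 < t) (hl : 0 ≤ l) : 0 ≤ cA t l := by
  have : 0 ≤ sinh (2 * l * t) := sinh_nonneg_iff.2 (by positivity)
  have := cosh_pos (2 * l * t)
  unfold cA; positivity

theorem cA_le {t l : ℝ} (ht : 0 < t) (hl : 0 ≤ l) : cA t l ≤ 1 / (4 * t) + l / 2 := by
  rcases hl.eq_or_lt with rfl | hl
  · simp [cA]; positivity
  have h : 2 * l * t ≤ sinh (2 * l * t) := self_le_sinh_iff.2 (by positivity)
  have hs : 0 < sinh (2 * l * t) := sinh_pos_iff.2 (by positivity)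
  have h2 : cosh (2 * l * t) ≤ 1 + sinh (2 * l * t) := by
    have h3 := cosh_sub_sinh (2 * l * t)
    have : exp (-(2 * l * t)) ≤ 1 := exp_le_one_iff.2 (by simp; positivity)
    linarith
  have h4 : cosh (2 * l * t) / sinh (2 * l * t) ≤ 1 / (2 * l * t) + 1 := by
    rw [div_le_iff₀ hs]
    have : 1 ≤ 1 / (2 * l * t) * sinh (2 * l * t) := by
      rw [one_div_mul_eq_div, le_div_iff₀ (by positivity)]; linarith
    linarith
  calc cA t l ≤ l / 2 * (1 / (2 * l * t) + 1) := mul_le_mul_of_nonneg_left h4 (by positivity)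
    _ = _ := by field_simp; ring

theorem tanh_nonneg' {x : ℝ} (hx : 0 ≤ x) : 0 ≤ tanh x := by
  rw [tanh_eq_sinh_div_cosh]
  exact div_nonneg (sinh_nonneg_iff.2 hx) (cosh_pos x).le

theorem tanh_le_self' {x : ℝ} (hx : 0 ≤ x) : sinh x ≤ x * cosh x := by
  have hm : MonotoneOn (fun x : ℝ => x * cosh x - sinh x) (Ici 0) := by
    apply monotoneOn_of_deriv_nonneg (convex_Ici 0)
    · exact (by fun_prop : Continuous fun x : ℝ => x * cosh x - sinh x).continuousOn
    · intro x _
      exact (((hasDerivAt_id x).mul (hasDerivAt_cosh x)).sub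
        (hasDerivAt_sinh x)).differentiableAt.differentiableWithinAt
    · intro x hx
      rw [interior_Ici] at hx
      have : HasDerivAt (fun x : ℝ => x * cosh x - sinh x) (1 * cosh x + x * sinh x - cosh x) x :=
        ((hasDerivAt_id x).mul (hasDerivAt_cosh x)).sub (hasDerivAt_sinh x)
      rw [this.deriv]
      have := mul_nonneg (le_of_lt hx) (sinh_nonneg_iff.2 (le_of_lt hx))
      linarith
  have := hm self_mem_Ici hx hx
  simp at this
  linarith

theorem cB_nonneg {t l : ℝ} (ht : 0 < t) (hl : 0 ≤ l) : 0 ≤ cB t l :=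
  mul_nonneg hl (tanh_nonneg' (by positivity))

theorem cB_le {t l : ℝ} (hl : 0 ≤ l) : cB t l ≤ l := by
  have := (tanh_lt_one (l * t)).le
  unfold cB
  nlinarith

theorem dotp_eq {n : ℕ} (a b : EuclideanSpace ℝ (Fin n)) : dotp a b = inner ℝ a b := by
  simp [dotp, PiLp.inner_apply, mul_comm]

theorem quad_lower {n : ℕ} {t l : ℝ} (ht : 0 < t) (hl : 0 < l) (x y : EuclideanSpace ℝ (Fin n)) :
    1 / (4 * t) * ‖x - y‖ ^ 2 ≤ cA t l * ‖x - y‖ ^ 2 + cB t l * dotp x y := by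
  have hs : 0 < l * t := by positivity
  have h1 : 0 < sinh (l * t) := sinh_pos_iff.2 hs
  have h2 := cosh_pos (l * t)
  have hd : dotp x y = (‖x + y‖ ^ 2 - ‖x - y‖ ^ 2) / 4 := by
    rw [dotp_eq, norm_add_sq_real, norm_sub_sq_real]; ring
  have hA : cA t l = l / 4 * (cosh (l * t) / sinh (l * t) + sinh (l * t) / cosh (l * t)) := by
    unfold cA
    rw [mul_assoc 2, sinh_two_mul, cosh_two_mul]
    field_simp
    ring
  have hB : cB t l = l * (sinh (l * t) / cosh (l * t)) := by
    unfold cB; rw [tanh_eq_sinh_div_cosh]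
  have h3 : 1 / (4 * t) ≤ l / 4 * (cosh (l * t) / sinh (l * t)) := by
    have := tanh_le_self' hs.le
    rw [mul_div_assoc', div_le_div_iff₀ (by positivity) h1]
    nlinarith
  rw [hA, hB, hd]
  have h4 : 0 ≤ l * (sinh (l * t) / cosh (l * t)) * ‖x + y‖ ^ 2 := by positivity
  have h5 := mul_le_mul_of_nonneg_right h3 (sq_nonneg ‖x - y‖)
  nlinarith

open Topology in
theorem cA_tendsto {t : ℝ} (ht : 0 < t) : Tendsto (cA t) (𝓝[>] 0) (𝓝 (1 / (4 * t))) := by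
  have h0 : Tendsto (fun l : ℝ => 2 * l * t) (𝓝[>] 0) (𝓝[≠] 0) := by
    rw [tendsto_nhdsWithin_iff]
    constructor
    · have : Tendsto (fun l : ℝ => 2 * l * t) (𝓝 0) (𝓝 (2 * 0 * t)) :=
        (by fun_prop : Continuous fun l : ℝ => 2 * l * t).tendsto 0
      simp only [mul_zero, zero_mul] at this
      exact this.mono_left nhdsWithin_le_nhds
    · filter_upwards [self_mem_nhdsWithin] with l hl
      have : (0 : ℝ) < l := hl
      have : 2 * l * t ≠ 0 := by positivity
      simpa using this
  have h1 := (hasDerivAt_iff_tendsto_slope.1 (hasDerivAt_sinh 0)).comp h0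
  have h2 : Tendsto (fun l : ℝ => cosh (2 * l * t)) (𝓝[>] 0) (𝓝 1) := by
    have : Tendsto (fun l : ℝ => cosh (2 * l * t)) (𝓝 0) (𝓝 (cosh (2 * 0 * t))) :=
      (by fun_prop : Continuous fun l : ℝ => cosh (2 * l * t)).tendsto 0
    simp only [mul_zero, zero_mul, cosh_zero] at this
    exact this.mono_left nhdsWithin_le_nhds
  rw [cosh_zero] at h1
  have h3 := (h2.div h1 one_ne_zero).mul_const (1 / (4 * t))
  simp only [div_one, one_mul] at h3
  refine h3.congr' ?_
  filter_upwards [self_mem_nhdsWithin] with l hl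
  have hl : (0 : ℝ) < l := hl
  have hs : 0 < sinh (2 * l * t) := sinh_pos_iff.2 (by positivity)
  simp only [Pi.div_apply, Function.comp_apply, slope_def_field, sinh_zero, sub_zero, cA]
  field_simp
  ring

open Topology in
theorem cP_tendsto (n : ℕ) {t : ℝ} (ht : 0 < t) :
    Tendsto (cP n t) (𝓝[>] 0) (𝓝 ((1 / (4 * π * t)) ^ ((n : ℝ) / 2))) := by
  have hbase : Tendsto (fun l : ℝ => l / (2 * π * sinh (2 * l * t))) (𝓝[>] 0)
      (𝓝 (1 / (4 * π * t))) := by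
    have h2 : Tendsto (fun l : ℝ => cosh (2 * l * t)) (𝓝[>] 0) (𝓝 1) := by
      have : Tendsto (fun l : ℝ => cosh (2 * l * t)) (𝓝 0) (𝓝 (cosh (2 * 0 * t))) :=
        (by fun_prop : Continuous fun l : ℝ => cosh (2 * l * t)).tendsto 0
      simp only [mul_zero, zero_mul, cosh_zero] at this
      exact this.mono_left nhdsWithin_le_nhds
    have h3 := ((cA_tendsto ht).div h2 one_ne_zero).mul_const (1 / π)
    have e : 1 / (4 * t) / 1 * (1 / π) = 1 / (4 * π * t) := by field_simp
    rw [e] at h3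
    refine h3.congr' ?_
    filter_upwards [self_mem_nhdsWithin] with l hl
    have hl : (0 : ℝ) < l := hl
    have hs : 0 < sinh (2 * l * t) := sinh_pos_iff.2 (by positivity)
    have hc := cosh_pos (2 * l * t)
    simp only [Pi.div_apply, cA]
    field_simp
  exact hbase.rpow_const (Or.inr (by positivity))

open Topology in
theorem cB_tendsto {t : ℝ} : Tendsto (cB t) (𝓝[>] 0) (𝓝 0) := by
  have h : Continuous (cB t) := by
    unfold cB
    simp only [tanh_eq_sinh_div_cosh]
    refine continuous_id.mul (Continuous.div (by fun_prop) (by fun_prop) fun l => (cosh_pos _).ne')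
  have := h.tendsto 0
  simp only [cB, zero_mul] at this
  exact this.mono_left nhdsWithin_le_nhds

/-! ### The differentiated kernel -/

def gphi {n : ℕ} (i : Fin n) (t p A B : ℝ) (x y : EuclideanSpace ℝ (Fin n)) : ℝ :=
  p * exp (-t - x i + y i - A * ‖x - y‖ ^ 2 - B * dotp x y)

def gL {n : ℕ} (i : Fin n) (A B : ℝ) (x y : EuclideanSpace ℝ (Fin n)) : ℝ :=
  2 * A * (x i - y i) + B * y i + 1

def gker {n : ℕ} (i : Fin n) (k : ℕ) (t p A B : ℝ) (x y : EuclideanSpace ℝ (Fin n)) : ℝ :=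
  (-1) ^ k * (qP k A (gL i A B x y) * gphi i t p A B x y)

theorem gker_deriv {n : ℕ} (i : Fin n) (k : ℕ) (t p A B : ℝ) (x y : EuclideanSpace ℝ (Fin n))
    (s : ℝ) : HasDerivAt (fun s : ℝ => gker i k t p A B (x + s • EuclideanSpace.single i 1) y)
      (gker i (k + 1) t p A B (x + s • EuclideanSpace.single i 1) y) s := by
  have hc : ∀ s : ℝ, (x + s • EuclideanSpace.single i (1 : ℝ)) i = x i + s := by
    intro s; simp
  have hn : ∀ s : ℝ, ‖x + s • EuclideanSpace.single i (1 : ℝ) - y‖ ^ 2 =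
      ‖x - y‖ ^ 2 + 2 * (s * (x i - y i)) + s ^ 2 := by
    intro s
    have : x + s • EuclideanSpace.single i (1 : ℝ) - y
      = (x - y) + s • EuclideanSpace.single i (1 : ℝ) := by abel
    rw [this, norm_add_sq_real, inner_smul_right, norm_smul]
    simp [EuclideanSpace.inner_single_right]
  have hd : ∀ s : ℝ, dotp (x + s • EuclideanSpace.single i (1 : ℝ)) y = dotp x y + s * y i := by
    intro s
    rw [dotp_eq, dotp_eq, inner_add_left, inner_smul_left]
    simp [EuclideanSpace.inner_single_left]
  apply qP_deriv_exp A k (fun s => gL i A B (x + s • EuclideanSpace.single i 1) y)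
    (fun s => gphi i t p A B (x + s • EuclideanSpace.single i 1) y) s
  · simp only [gL, hc]
    have := ((((hasDerivAt_id s).const_add (x i)).sub_const (y i)).const_mul (2 * A)).add_const
      (B * y i) |>.add_const 1
    simpa using this
  · simp only [gphi, gL, hc, hn, hd]
    have hid := hasDerivAt_id s
    have h1 : HasDerivAt (fun s : ℝ => -t - (x i + s) + y i -
        A * (‖x - y‖ ^ 2 + 2 * (s * (x i - y i)) + s ^ 2) - B * (dotp x y + s * y i))
        (-1 - A * (2 * (1 * (x i - y i)) + 2 * s) - B * (1 * y i)) s := by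
      refine HasDerivAt.sub (HasDerivAt.sub ?_ ?_) ?_
      · exact ((hid.const_add (x i)).const_sub (-t)).add_const (y i)
      · refine HasDerivAt.const_mul A (HasDerivAt.add ?_ ?_)
        · exact ((hid.mul_const (x i - y i)).const_mul 2).const_add _
        · simpa using hasDerivAt_pow 2 s
      · exact HasDerivAt.const_mul B ((hid.mul_const (y i)).const_add _)
    refine (h1.exp.const_mul p).congr_deriv ?_
    ring

/-- Admissible coefficients. -/
structure GoodC (n : ℕ) (t r p A B : ℝ) : Prop where
  A0 : 0 ≤ A
  A1 : A ≤ 1 / (4 * t) + r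
  B0 : 0 ≤ B
  B1 : B ≤ r
  p0 : 0 ≤ p
  bd : ∀ x y : EuclideanSpace ℝ (Fin n), p * exp (-A * ‖x - y‖ ^ 2 - B * dotp x y) ≤
    (1 / (4 * π * t)) ^ ((n : ℝ) / 2) * exp (-(1 / (4 * t) * ‖x - y‖ ^ 2))

theorem goodC_c {n : ℕ} (hn : 0 < n) {t l r : ℝ} (ht : 0 < t) (hl : 0 ≤ l) (hr : l ≤ r) :
    GoodC n t r (cP n t l) (cA t l) (cB t l) where
  A0 := cA_nonneg ht hl
  A1 := (cA_le ht hl).trans (by linarith)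
  B0 := cB_nonneg ht hl
  B1 := (cB_le hl).trans hr
  p0 := cP_nonneg n ht hl
  bd := by
    intro x y
    rcases hl.eq_or_lt with rfl | hl
    · rw [cP_zero n hn]; simp only [zero_mul]; positivity
    · refine mul_le_mul (cP_le n ht hl.le) (exp_le_exp.2 ?_) (by positivity) (by positivity)
      have := quad_lower ht hl x y
      linarith

theorem goodC_lim (n : ℕ) {t r : ℝ} (ht : 0 < t) (hr : 0 ≤ r) :
    GoodC n t r ((1 / (4 * π * t)) ^ ((n : ℝ) / 2)) (1 / (4 * t)) 0 where
  A0 := by positivity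
  A1 := by linarith
  B0 := le_rfl
  B1 := hr
  p0 := by positivity
  bd := by intro x y; simp

theorem abs_coord_le {n : ℕ} (x : EuclideanSpace ℝ (Fin n)) (i : Fin n) : |x i| ≤ ‖x‖ := by
  simpa using PiLp.norm_apply_le x i

theorem gker_bound {n : ℕ} (i : Fin n) (k : ℕ) : ∃ c : ℝ, 0 ≤ c ∧
    ∀ t r p A B R : ℝ, 0 < t → 0 ≤ r → 1 ≤ R → GoodC n t r p A B →
    ∀ x y : EuclideanSpace ℝ (Fin n), ‖x‖ ≤ R → ‖y‖ ≤ R →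
    |gker i k t p A B x y| ≤ c * (R * (1 + 1 / t) * (1 + r)) ^ k *
      ((1 / (4 * π * t)) ^ ((n : ℝ) / 2) * exp (-t + 2 * R - 1 / (4 * t) * ‖x - y‖ ^ 2)) := by
  obtain ⟨c, hc, hq⟩ := qP_bound k
  refine ⟨c * 8 ^ k, by positivity, ?_⟩
  intro t r p A B R ht hr hR hG x y hx hy
  have hxi := (abs_coord_le x i).trans hx
  have hyi := (abs_coord_le y i).trans hy
  have hφ0 : 0 ≤ gphi i t p A B x y := mul_nonneg hG.p0 (exp_pos _).le
  have hφ : gphi i t p A B x y ≤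
      (1 / (4 * π * t)) ^ ((n : ℝ) / 2) * exp (-t + 2 * R - 1 / (4 * t) * ‖x - y‖ ^ 2) := by
    have e1 : gphi i t p A B x y = (p * exp (-A * ‖x - y‖ ^ 2 - B * dotp x y)) *
        exp (-t - x i + y i) := by
      rw [gphi, mul_assoc, ← exp_add]; ring_nf
    rw [e1]
    calc _ ≤ ((1 / (4 * π * t)) ^ ((n : ℝ) / 2) * exp (-(1 / (4 * t) * ‖x - y‖ ^ 2))) *
          exp (-t + 2 * R) := by
          refine mul_le_mul (hG.bd x y) (exp_le_exp.2 ?_) (by positivity) (by positivity)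
          have := neg_abs_le (x i); have := le_abs_self (y i); linarith
      _ = _ := by rw [mul_assoc, ← exp_add]; ring_nf
  have hw : 1 + A + |gL i A B x y| ≤ 8 * (R * (1 + 1 / t) * (1 + r)) := by
    set w := (1 + 1 / t) * (1 + r) with hwd
    have ht' : 0 < 1 / t := by positivity
    have hq4 : 1 / (4 * t) ≤ 1 / t := by
      rw [div_le_div_iff₀ (by positivity) ht]; linarith
    have hAw : A ≤ w := by have := hG.A1; nlinarith
    have hrw : r ≤ w := by nlinarith
    have h1w : 1 ≤ w := by nlinarith
    have h1 : |gL i A B x y| ≤ 2 * w * (2 * R) + w * R + 1 := by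
      unfold gL
      have a1 : |2 * A * (x i - y i)| ≤ 2 * w * (2 * R) := by
        rw [abs_mul, abs_of_nonneg (by have := hG.A0; positivity)]
        refine mul_le_mul (by linarith) ?_ (abs_nonneg _) (by positivity)
        calc _ ≤ |x i| + |y i| := abs_sub _ _
          _ ≤ _ := by linarith
      have a2 : |B * y i| ≤ w * R := by
        rw [abs_mul, abs_of_nonneg hG.B0]
        exact mul_le_mul (hG.B1.trans hrw) hyi (abs_nonneg _) (by positivity)
      calc _ ≤ |2 * A * (x i - y i)| + |B * y i| + |(1 : ℝ)| := abs_add_three _ _ _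
        _ ≤ _ := by rw [abs_one]; linarith
    have : w ≤ w * R := le_mul_of_one_le_right (by positivity) hR
    have e : R * (1 + 1 / t) * (1 + r) = w * R := by rw [hwd]; ring
    rw [e]; linarith
  unfold gker
  rw [abs_mul, abs_pow, abs_neg, abs_one, one_pow, one_mul, abs_mul, abs_of_nonneg hφ0]
  have hq' : |qP k A (gL i A B x y)| ≤ c * 8 ^ k * (R * (1 + 1 / t) * (1 + r)) ^ k := by
    refine (hq A _ hG.A0).trans ?_
    rw [mul_assoc, ← mul_pow]
    have := hG.A0
    gcongr
  exact mul_le_mul hq' hφ hφ0 (by positivity)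

theorem measurable_cA : Measurable fun z : ℝ × ℝ => cA z.1 z.2 := by
  unfold cA; fun_prop
theorem measurable_cB : Measurable fun z : ℝ × ℝ => cB z.1 z.2 := by
  unfold cB; simp only [tanh_eq_sinh_div_cosh]; fun_prop
theorem measurable_cP (n : ℕ) : Measurable fun z : ℝ × ℝ => cP n z.1 z.2 := by
  unfold cP; fun_prop

theorem measurable_gker {n : ℕ} {Ω : Type*} [MeasurableSpace Ω] (i : Fin n) (k : ℕ)
    (t p A B : Ω → ℝ) (x y : Ω → EuclideanSpace ℝ (Fin n)) (ht : Measurable t)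
    (hp : Measurable p) (hA : Measurable A) (hB : Measurable B) (hx : Measurable x)
    (hy : Measurable y) :
    Measurable fun ω => gker i k (t ω) (p ω) (A ω) (B ω) (x ω) (y ω) := by
  have hxi : ∀ i, Measurable fun ω => x ω i := fun i =>
    (by fun_prop : Continuous fun v : EuclideanSpace ℝ (Fin n) => v i).measurable.comp hx
  have hyi : ∀ i, Measurable fun ω => y ω i := fun i =>
    (by fun_prop : Continuous fun v : EuclideanSpace ℝ (Fin n) => v i).measurable.comp hy
  have hL : Measurable fun ω => gL i (A ω) (B ω) (x ω) (y ω) := by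
    unfold gL
    exact (((hA.const_mul 2).mul ((hxi i).sub (hyi i))).add (hB.mul (hyi i))).add_const 1
  have hφ : Measurable fun ω => gphi i (t ω) (p ω) (A ω) (B ω) (x ω) (y ω) := by
    unfold gphi dotp
    refine hp.mul (Measurable.exp ?_)
    refine ((((ht.neg).sub (hxi i)).add (hyi i)).sub (hA.mul ((hx.sub hy).norm.pow_const 2))).sub
      (hB.mul (Finset.measurable_fun_sum _ fun j _ => (hxi j).mul (hyi j)))
  unfold gker
  exact (((qP_continuous k).measurable.comp (hA.prodMk hL)).mul hφ).const_mul _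

open Topology in
theorem gker_tendsto {n : ℕ} (i : Fin n) (k : ℕ) {t : ℝ} (ht : 0 < t)
    (x y : EuclideanSpace ℝ (Fin n)) :
    Tendsto (fun l => gker i k t (cP n t l) (cA t l) (cB t l) x y) (𝓝[>] 0)
      (𝓝 (gker i k t ((1 / (4 * π * t)) ^ ((n : ℝ) / 2)) (1 / (4 * t)) 0 x y)) := by
  have hc : Continuous fun z : ℝ × ℝ × ℝ => gker i k t z.1 z.2.1 z.2.2 x y := by
    unfold gker gphi
    refine continuous_const.mul (Continuous.mul ?_ (by fun_prop))
    have h2 : Continuous fun z : ℝ × ℝ × ℝ => gL i z.2.1 z.2.2 x y := by unfold gL; fun_prop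
    exact (qP_continuous k).comp ((continuous_fst.comp continuous_snd).prodMk h2)
  exact (hc.tendsto ((1 / (4 * π * t)) ^ ((n : ℝ) / 2), 1 / (4 * t), 0)).comp
    ((cP_tendsto n ht).prodMk_nhds ((cA_tendsto ht).prodMk_nhds cB_tendsto))

/-! ### The Fourier side -/

open scoped FourierTransform SchwartzMap

def hhat {m : ℕ} (h : 𝓢(EuclideanSpace ℝ (Fin m), ℂ)) (ν : EuclideanSpace ℝ (Fin m)) : ℂ :=
  ∫ η, h η * Complex.exp (Complex.I * ((dotp ν η : ℝ) : ℂ))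

def WW {m : ℕ} (h : 𝓢(EuclideanSpace ℝ (Fin m), ℂ)) (ν ξ : EuclideanSpace ℝ (Fin m)) : ℂ :=
  ((((2 * π) ^ m)⁻¹ : ℝ) : ℂ) * (hhat h ν * Complex.exp (-Complex.I * ((dotp ν ξ : ℝ) : ℂ)))

theorem hhat_eq {m : ℕ} (h : 𝓢(EuclideanSpace ℝ (Fin m), ℂ)) (ν : EuclideanSpace ℝ (Fin m)) :
    hhat h ν = (𝓕⁻ h) ((2 * π)⁻¹ • ν) := by
  rw [SchwartzMap.fourierInv_coe, Real.fourierInv_eq', hhat]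
  congr 1
  ext η
  rw [inner_smul_right, dotp_eq, real_inner_comm, smul_eq_mul, mul_comm]
  congr 2
  have : (π : ℂ) ≠ 0 := by exact_mod_cast pi_ne_zero
  push_cast
  field_simp

theorem hhat_continuous {m : ℕ} (h : 𝓢(EuclideanSpace ℝ (Fin m), ℂ)) : Continuous (hhat h) := by
  have : hhat h = fun ν => (𝓕⁻ h) ((2 * π)⁻¹ • ν) := funext (hhat_eq h)
  rw [this]
  exact (𝓕⁻ h).continuous.comp (by fun_prop)

theorem hhat_integrable {m : ℕ} (h : 𝓢(EuclideanSpace ℝ (Fin m), ℂ)) (k : ℕ) :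
    Integrable fun ν => (1 + ‖ν‖) ^ k * ‖hhat h ν‖ := by
  have h1 : Integrable fun ν => ‖ν‖ ^ k * ‖hhat h ν‖ := by
    have := (((𝓕⁻ h).integrable_pow_mul volume k).comp_smul
      (R := (2 * π)⁻¹) (by positivity)).const_mul ((2 * π) ^ k)
    refine this.congr (Eventually.of_forall fun ν => ?_)
    simp only [hhat_eq, norm_smul]
    rw [Real.norm_of_nonneg (by positivity), ← mul_assoc, ← mul_pow, ← mul_assoc,
      mul_inv_cancel₀ (by positivity), one_mul]
  have h0 : Integrable fun ν => ‖hhat h ν‖ := by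
    have := ((𝓕⁻ h).integrable_pow_mul volume 0).comp_smul (R := (2 * π)⁻¹) (by positivity)
    simpa [hhat_eq] using this
  refine ((h0.add h1).const_mul (2 ^ (k - 1))).mono' ?_ (Eventually.of_forall fun ν => ?_)
  · have := hhat_continuous h
    exact (by fun_prop : Continuous fun ν => (1 + ‖ν‖) ^ k * ‖hhat h ν‖).aestronglyMeasurable
  · rw [Real.norm_of_nonneg (by positivity)]
    have := add_pow_le (zero_le_one) (norm_nonneg ν) k
    calc _ ≤ (2 ^ (k - 1) * (1 ^ k + ‖ν‖ ^ k)) * ‖hhat h ν‖ := by gcongr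
      _ = _ := by simp only [one_pow, Pi.add_apply]; ring

theorem WW_norm {m : ℕ} (h : 𝓢(EuclideanSpace ℝ (Fin m), ℂ)) (ν ξ : EuclideanSpace ℝ (Fin m)) :
    ‖WW h ν ξ‖ = ((2 * π) ^ m)⁻¹ * ‖hhat h ν‖ := by
  have : -Complex.I * ((dotp ν ξ : ℝ) : ℂ) = ((-(dotp ν ξ) : ℝ) : ℂ) * Complex.I := by
    push_cast; ring
  rw [WW, norm_mul, norm_mul, this, Complex.norm_exp_ofReal_mul_I, mul_one,
    Complex.norm_of_nonneg (by positivity)]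

theorem WW_continuous {m : ℕ} (h : 𝓢(EuclideanSpace ℝ (Fin m), ℂ)) (ξ : EuclideanSpace ℝ (Fin m)) :
    Continuous fun ν => WW h ν ξ := by
  have := hhat_continuous h
  unfold WW dotp
  fun_prop

theorem WW_integrable {m : ℕ} (h : 𝓢(EuclideanSpace ℝ (Fin m), ℂ)) (k : ℕ) (C : ℝ)
     (ξ : EuclideanSpace ℝ (Fin m)) :
    Integrable fun ν => (C * (1 + ‖ν‖)) ^ k * ‖WW h ν ξ‖ := by
  refine ((hhat_integrable h k).const_mul (C ^ k * ((2 * π) ^ m)⁻¹)).congr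
    (Eventually.of_forall fun ν => ?_)
  simp only [WW_norm, mul_pow]; ring

theorem WW_integral {m : ℕ} (h : 𝓢(EuclideanSpace ℝ (Fin m), ℂ)) (ξ : EuclideanSpace ℝ (Fin m)) :
    ∫ ν, WW h ν ξ = h ξ := by
  have h1 : h ξ = (𝓕 (𝓕⁻ h)) ξ := by rw [FourierTransform.fourier_fourierInv_eq]
  rw [h1, SchwartzMap.fourier_coe, Real.fourier_eq']
  have h2 := Measure.integral_comp_smul_of_nonneg volume
    (fun v => Complex.exp ((((-2 * π * inner ℝ v ξ : ℝ) : ℂ)) * Complex.I) • (𝓕⁻ h) v) ((2 * π)⁻¹)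
      (hR := by positivity)
  rw [finrank_euclideanSpace, Fintype.card_fin] at h2
  have h3 : ∫ v, Complex.exp ((((-2 * π * inner ℝ v ξ : ℝ) : ℂ)) * Complex.I) • (𝓕⁻ h) v =
    ((2 * π) ^ m)⁻¹ • ∫ ν, Complex.exp ((((-2 * π * inner ℝ ((2 * π)⁻¹ • ν) ξ : ℝ) : ℂ)) * Complex.I)
       • (𝓕⁻ h) ((2 * π)⁻¹ • ν) := by
    rw [h2, smul_smul, inv_pow, inv_inv, inv_mul_cancel₀ (by positivity), one_smul]
  rw [h3, ← integral_smul]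
  congr 1
  ext ν
  rw [WW, hhat_eq, Complex.real_smul, smul_eq_mul, mul_comm (Complex.exp _), dotp_eq,
    inner_smul_left]
  congr 3
  have : (π : ℂ) ≠ 0 := by exact_mod_cast pi_ne_zero
  push_cast
  simp
  field_simp

theorem integral_hscale {m : ℕ} (h : 𝓢(EuclideanSpace ℝ (Fin m), ℂ)) {ε : ℝ} (hε : 0 < ε)
    (ν x : EuclideanSpace ℝ (Fin m)) :
    ((((2 * π) ^ m)⁻¹ : ℝ) : ℂ) * ∫ y, h (ε • y) *
        Complex.exp (-Complex.I * ((dotp (ε • ν) (x - y) : ℝ) : ℂ)) =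
      (((ε ^ m)⁻¹ : ℝ) : ℂ) * WW h ν (ε • x) := by
  have e : ∀ y, h (ε • y) * Complex.exp (-Complex.I * ((dotp (ε • ν) (x - y) : ℝ) : ℂ)) =
      (fun z => (h z * Complex.exp (Complex.I * ((dotp ν z : ℝ) : ℂ))) *
       Complex.exp (-Complex.I * ((dotp ν (ε • x) : ℝ) : ℂ))) (ε • y) := by
    intro y
    simp only [dotp_eq, inner_sub_right, inner_smul_left, inner_smul_right]
    rw [mul_assoc, ← Complex.exp_add]
    congr 2
    push_cast
    simp
    ring
  have e2 := Measure.integral_comp_smul_of_nonneg volume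
    (fun z => (h z * Complex.exp (Complex.I * ((dotp ν z : ℝ) : ℂ))) *
       Complex.exp (-Complex.I * ((dotp ν (ε • x) : ℝ) : ℂ))) ε (hR := hε.le)
  rw [integral_congr_ae (Eventually.of_forall e), e2, integral_mul_const, WW, hhat,
    finrank_euclideanSpace, Fintype.card_fin, Complex.real_smul]
  ring

theorem integrable_exp_neg_norm (m : ℕ) {c : ℝ} (hc : 0 < c) :
    Integrable fun ν : EuclideanSpace ℝ (Fin m) => exp (-c * ‖ν‖) := by
  have h1 : Integrable fun ν : EuclideanSpace ℝ (Fin m) => (1 + ‖ν‖) ^ (-((m + 1 : ℕ) : ℝ)) := by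
    apply integrable_one_add_norm
    simp
  refine (h1.const_mul ((m + 1).factorial / c ^ (m + 1) * exp c)).mono'
    (by fun_prop : Continuous fun ν : EuclideanSpace ℝ (Fin m) => exp (-c * ‖ν‖)).aestronglyMeasurable
    (Eventually.of_forall fun ν => ?_)
  rw [Real.norm_of_nonneg (exp_pos _).le, rpow_neg (by positivity), rpow_natCast]
  have h2 := pow_div_factorial_le_exp (c * (1 + ‖ν‖)) (by positivity) (m + 1)
  have h3 : exp (c * (1 + ‖ν‖)) * exp (-c * ‖ν‖) = exp c := by rw [← exp_add]; ring_nf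
  have hf : (0 : ℝ) < (m + 1).factorial := by exact_mod_cast Nat.factorial_pos _
  rw [← h3]
  calc exp (-c * ‖ν‖) = ((m + 1).factorial / c ^ (m + 1) * (((c * (1 + ‖ν‖)) ^ (m + 1)) /
        (m + 1).factorial)) * ((1 + ‖ν‖) ^ (m + 1))⁻¹ * exp (-c * ‖ν‖) := by
        rw [mul_pow]; field_simp
    _ ≤ ((m + 1).factorial / c ^ (m + 1) * exp (c * (1 + ‖ν‖))) *
        ((1 + ‖ν‖) ^ (m + 1))⁻¹ * exp (-c * ‖ν‖) := by gcongr
    _ = _ := by ring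

/-! ### Formula for the semigroup applied to the test functions and its derivatives -/

open scoped FourierTransform SchwartzMap

/-- the test function -/
def ftest {n m : ℕ} (g : EuclideanSpace ℝ (Fin n) → ℝ) (h : 𝓢(EuclideanSpace ℝ (Fin m), ℂ)) (ε : ℝ)
    (y : Ep n m) : ℂ := (g y.1 : ℂ) * h (ε • y.2)

def integ {n m : ℕ} (i : Fin n) (g : EuclideanSpace ℝ (Fin n) → ℝ)
    (h : 𝓢(EuclideanSpace ℝ (Fin m), ℂ)) (ε : ℝ) (k : ℕ) (t : ℝ) (x' : EuclideanSpace ℝ (Fin n))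
    (ξ : EuclideanSpace ℝ (Fin m))
    (z : EuclideanSpace ℝ (Fin m) × EuclideanSpace ℝ (Fin n)) : ℂ :=
  WW h z.1 ξ * ((g z.2 * gker i k t (cP n t (ε * ‖z.1‖)) (cA t (ε * ‖z.1‖)) (cB t (ε * ‖z.1‖))
    x' z.2 : ℝ) : ℂ)

theorem measurable_ker_eps {n m : ℕ} (i : Fin n) (ε : ℝ) (k : ℕ) (x' : EuclideanSpace ℝ (Fin n)) :
    Measurable fun z : ℝ × EuclideanSpace ℝ (Fin m) × EuclideanSpace ℝ (Fin n) =>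
      gker i k z.1 (cP n z.1 (ε * ‖z.2.1‖)) (cA z.1 (ε * ‖z.2.1‖)) (cB z.1 (ε * ‖z.2.1‖))
    x' z.2.2 := by
  have h1 : Measurable fun z : ℝ × EuclideanSpace ℝ (Fin m) × EuclideanSpace ℝ (Fin n) =>
    (z.1, ε * ‖z.2.1‖) := by fun_prop
  exact measurable_gker i k _ _ _ _ _ _ measurable_fst ((measurable_cP n).comp h1)
    (measurable_cA.comp h1) (measurable_cB.comp h1) measurable_const
    (measurable_snd.comp measurable_snd)

theorem measurable_integ {n m : ℕ} (i : Fin n) (g : EuclideanSpace ℝ (Fin n) → ℝ)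
    (hg : Continuous g)
    (h : 𝓢(EuclideanSpace ℝ (Fin m), ℂ)) (ε : ℝ) (k : ℕ) (x' : EuclideanSpace ℝ (Fin n))
    (ξ : EuclideanSpace ℝ (Fin m)) :
    Measurable fun z : ℝ × EuclideanSpace ℝ (Fin m) × EuclideanSpace ℝ (Fin n) =>
      integ i g h ε k z.1 x' ξ z.2 := by
  unfold integ
  refine Measurable.mul ?_ (Complex.measurable_ofReal.comp (Measurable.mul ?_
    (measurable_ker_eps i ε k x')))
  · exact (WW_continuous h ξ).measurable.comp (measurable_fst.comp measurable_snd)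
  · exact hg.measurable.comp (measurable_snd.comp measurable_snd)

theorem measurable_comp_pair {Y Z : Type*} [MeasurableSpace Y] [MeasurableSpace Z] 
    (F : ℝ × Y → Z) (hF : Measurable F) (t : ℝ) : Measurable fun z => F (t, z) :=
  hF.comp measurable_prodMk_left

attribute [irreducible] integ

theorem measurable_integ' {n m : ℕ} (i : Fin n) (g : EuclideanSpace ℝ (Fin n) → ℝ)
    (hg : Continuous g)
    (h : 𝓢(EuclideanSpace ℝ (Fin m), ℂ)) (ε : ℝ) (k : ℕ) (t : ℝ) (x' : EuclideanSpace ℝ (Fin n))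
    (ξ : EuclideanSpace ℝ (Fin m)) :
    Measurable (integ i g h ε k t x' ξ) := by
  have h1 := measurable_integ i g hg h ε k x' ξ
  have h3 := measurable_comp_pair _ h1 t
  exact h3

/-- pointwise bound, `g` supported in the ball of radius `2`, `|g| ≤ 1`. -/
theorem integ_bound {n m : ℕ} (hn : 0 < n) (i : Fin n) (k : ℕ) : ∃ c : ℝ, 0 ≤ c ∧
    ∀ (g : EuclideanSpace ℝ (Fin n) → ℝ) (_ : ∀ y, 2 ≤ ‖y‖ → g y = 0)
    (h : 𝓢(EuclideanSpace ℝ (Fin m), ℂ)) (ε t R : ℝ) (_ : 0 < ε) (_ : ε ≤ 1) (_ : 0 < t)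
    (_ : 2 ≤ R) (x' : EuclideanSpace ℝ (Fin n)) (_ : ‖x'‖ ≤ R) (ξ : EuclideanSpace ℝ (Fin m))
    (z : EuclideanSpace ℝ (Fin m) × EuclideanSpace ℝ (Fin n)),
    ‖integ i g h ε k t x' ξ z‖ ≤ c * ((1 + 1 / t) ^ k * ((1 / (4 * π * t)) ^ ((n : ℝ) / 2) *
      exp (-t + 2 * R - 1 / (4 * t) * ‖x' - z.2‖ ^ 2))) *
      ((R * (1 + ‖z.1‖)) ^ k * ‖WW h z.1 ξ‖ * |g z.2|) := by
  obtain ⟨c, hc, hb⟩ := gker_bound i k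
  refine ⟨c, hc, ?_⟩
  intro g hg h ε t R hε hε1 ht hR x' hx ξ z
  rw [integ, norm_mul, Complex.norm_real, norm_mul, Real.norm_eq_abs, Real.norm_eq_abs]
  by_cases hz : 2 ≤ ‖z.2‖
  · rw [hg _ hz]; simp
  · have h1 := hb t ‖z.1‖ _ _ _ R ht (norm_nonneg _) (by linarith)
      (goodC_c hn ht (by positivity : 0 ≤ ε * ‖z.1‖)
        (mul_le_of_le_one_left (norm_nonneg _) hε1)) x' z.2 hx (by linarith)
    calc _ ≤ ‖WW h z.1 ξ‖ * (|g z.2| * _) :=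
          mul_le_mul_of_nonneg_left (mul_le_mul_of_nonneg_left h1 (abs_nonneg _)) (norm_nonneg _)
      _ = _ := by rw [mul_pow, mul_pow, mul_pow]; ring

theorem integ_dom_integrable {n m : ℕ} (g : EuclideanSpace ℝ (Fin n) → ℝ) (hg : Continuous g)
    (hgc : HasCompactSupport g) (h : 𝓢(EuclideanSpace ℝ (Fin m), ℂ)) (k : ℕ) (R : ℝ)
    (ξ : EuclideanSpace ℝ (Fin m)) :
    Integrable fun z : EuclideanSpace ℝ (Fin m) × EuclideanSpace ℝ (Fin n) =>
      (R * (1 + ‖z.1‖)) ^ k * ‖WW h z.1 ξ‖ * |g z.2| :=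
  (WW_integrable h k R ξ).mul_prod (hg.integrable_of_hasCompactSupport hgc).abs

theorem integ_bound' {n m : ℕ} (hn : 0 < n) (i : Fin n) (k : ℕ) (g : EuclideanSpace ℝ (Fin n) → ℝ)
    (hg : ∀ y, 2 ≤ ‖y‖ → g y = 0) {t R : ℝ} (ht : 0 < t) (hR : 2 ≤ R) : ∃ c : ℝ, 0 ≤ c ∧ ∀
    (h : 𝓢(EuclideanSpace ℝ (Fin m), ℂ)) (ε : ℝ) (_ : 0 < ε) (_ : ε ≤ 1)
    (x' : EuclideanSpace ℝ (Fin n)) (_ : ‖x'‖ ≤ R) (ξ : EuclideanSpace ℝ (Fin m))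
    (z : EuclideanSpace ℝ (Fin m) × EuclideanSpace ℝ (Fin n)),
    ‖integ i g h ε k t x' ξ z‖ ≤ c * ((R * (1 + ‖z.1‖)) ^ k * ‖WW h z.1 ξ‖ * |g z.2|) := by
  obtain ⟨c, hc, hb⟩ := integ_bound (m := m) hn i k
  refine ⟨c * ((1 + 1 / t) ^ k * ((1 / (4 * π * t)) ^ ((n : ℝ) / 2) *
      exp (-t + 2 * R))), by positivity, ?_⟩
  intro h ε hε hε1 x' hx ξ z
  refine (hb g hg h ε t R hε hε1 ht hR x' hx ξ z).trans ?_
  have : 0 ≤ 1 / (4 * t) * ‖x' - z.2‖ ^ 2 := by positivity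
  gcongr
  linarith

theorem integ_integrable {n m : ℕ} (hn : 0 < n) (i : Fin n) (k : ℕ)
    (g : EuclideanSpace ℝ (Fin n) → ℝ) (hgc : Continuous g) (hgs : HasCompactSupport g)
    (hg : ∀ y, 2 ≤ ‖y‖ → g y = 0)
    (h : 𝓢(EuclideanSpace ℝ (Fin m), ℂ)) {ε t : ℝ} (hε : 0 < ε) (hε1 : ε ≤ 1) (ht : 0 < t)
    (x' : EuclideanSpace ℝ (Fin n)) (ξ : EuclideanSpace ℝ (Fin m)) :
    Integrable (integ i g h ε k t x' ξ) := by
  have hR : 2 ≤ 2 + ‖x'‖ := by have := norm_nonneg x'; linarith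
  obtain ⟨c, hc, hb⟩ := integ_bound' (m := m) hn i k g hg ht hR
  exact ((integ_dom_integrable g hgc hgs h k (2 + ‖x'‖) ξ).const_mul c).mono'
    (measurable_integ' i g hgc h ε k t x' ξ).aestronglyMeasurable
    (Eventually.of_forall fun z => hb h ε hε hε1 x' (by linarith) ξ z)

theorem integ_hasDerivAt {n m : ℕ} (hn : 0 < n) (i : Fin n) (k : ℕ)
    (g : EuclideanSpace ℝ (Fin n) → ℝ) (hgc : Continuous g) (hgs : HasCompactSupport g)
    (hg : ∀ y, 2 ≤ ‖y‖ → g y = 0)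
    (h : 𝓢(EuclideanSpace ℝ (Fin m), ℂ)) {ε t : ℝ} (hε : 0 < ε) (hε1 : ε ≤ 1) (ht : 0 < t)
    (x' : EuclideanSpace ℝ (Fin n)) (ξ : EuclideanSpace ℝ (Fin m)) :
    HasDerivAt (fun s : ℝ => ∫ z, integ i g h ε k t (x' + s • EuclideanSpace.single i 1) ξ z)
      (∫ z, integ i g h ε (k + 1) t x' ξ z) 0 := by
  have hR : 2 ≤ 2 + ‖x'‖ := by have := norm_nonneg x'; linarith
  obtain ⟨c, hc, hb⟩ := integ_bound' (m := m) hn i (k + 1) g hg ht hR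
  have key := (hasDerivAt_integral_of_dominated_loc_of_deriv_le
    (μ := (volume : Measure (EuclideanSpace ℝ (Fin m) × EuclideanSpace ℝ (Fin n)))) (x₀ := (0 : ℝ))
    (F := fun s z => integ i g h ε k t (x' + s • EuclideanSpace.single i 1) ξ z)
    (F' := fun s z => integ i g h ε (k + 1) t (x' + s • EuclideanSpace.single i 1) ξ z)
    (s := Metric.ball 0 1)
    (bound := fun z => c * (((2 + ‖x'‖) * (1 + ‖z.1‖)) ^ (k + 1) * ‖WW h z.1 ξ‖ * |g z.2|))
    (Metric.ball_mem_nhds _ one_pos)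
    (Eventually.of_forall fun s => (measurable_integ' i g hgc h ε k t _ ξ).aestronglyMeasurable)
    (integ_integrable hn i k g hgc hgs hg h hε hε1 ht _ ξ)
    (measurable_integ' i g hgc h ε (k + 1) t _ ξ).aestronglyMeasurable
    (Eventually.of_forall fun z s hs => hb h ε hε hε1 _ ?_ ξ z)
    ((integ_dom_integrable g hgc hgs h (k + 1) (2 + ‖x'‖) ξ).const_mul c)
    (Eventually.of_forall fun z s hs => ?_)).2
  · simp only [zero_smul, add_zero] at key
    exact key
  · have h1 := norm_add_le x' (s • EuclideanSpace.single i (1 : ℝ))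
    rw [norm_smul] at h1
    simp only [Metric.mem_ball, dist_zero_right] at hs
    simp at h1
    simp at hs
    linarith
  · have := (gker_deriv i k t (cP n t (ε * ‖z.1‖)) (cA t (ε * ‖z.1‖)) (cB t (ε * ‖z.1‖)) x' z.2
      s).const_mul (g z.2)
    have h2 := this.ofReal_comp.const_mul (WW h z.1 ξ)
    simp only [integ]
    exact h2

open scoped FourierTransform SchwartzMap

theorem gker_zero {n : ℕ} (i : Fin n) (t p A B : ℝ) (x y : EuclideanSpace ℝ (Fin n)) :
    gker i 0 t p A B x y = gphi i t p A B x y := by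
  simp [gker, qP]

theorem dotp_single {n : ℕ} (i : Fin n) (x : EuclideanSpace ℝ (Fin n)) :
    dotp (EuclideanSpace.single i 1) x = x i := by
  simp [dotp_eq, EuclideanSpace.inner_single_left]

theorem hermite_gker {n m : ℕ} (i : Fin n) (t : ℝ) (lam : EuclideanSpace ℝ (Fin m))
    (x y : EuclideanSpace ℝ (Fin n)) :
    rexp (-‖EuclideanSpace.single i (1 : ℝ)‖ ^ 2 * t) *
      rexp (-dotp (EuclideanSpace.single i 1) (x + y)) * hermiteK n t lam x y *
      rexp (2 * dotp (EuclideanSpace.single i 1) y) =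
    gker i 0 t (cP n t ‖lam‖) (cA t ‖lam‖) (cB t ‖lam‖) x y := by
  rw [gker_zero, gphi, hermiteK, dotp_single, dotp_single, ← cP]
  have h1 : ‖EuclideanSpace.single i (1 : ℝ)‖ = 1 := by simp
  rw [h1, PiLp.add_apply]
  have : ∀ a b c d p : ℝ, rexp a * rexp b * (p * rexp c) * rexp d = p * rexp (a + b + c + d) := by
    intro a b c d p; rw [exp_add, exp_add, exp_add]; ring
  rw [this]
  congr 2
  unfold cA cB
  ring

theorem gker0_le {n : ℕ} (hn : 0 < n) (i : Fin n) {t l : ℝ} (ht : 0 < t) (hl : 0 ≤ l)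
    (x y : EuclideanSpace ℝ (Fin n)) (hy : ‖y‖ ≤ 2) :
    |gker i 0 t (cP n t l) (cA t l) (cB t l) x y| ≤
      ((1 / (2 * π * t)) ^ ((n : ℝ) / 2) * rexp (-t - x i + 2)) * rexp (-(t * (n / 2)) * l) := by
  rw [gker_zero, gphi, abs_of_nonneg (mul_nonneg (cP_nonneg n ht hl) (exp_pos _).le)]
  rcases hl.eq_or_lt with rfl | hl
  · rw [cP_zero n hn]; simp only [zero_mul]; positivity
  · have h1 := quad_lower ht hl x y
    have h2 : 0 ≤ 1 / (4 * t) * ‖x - y‖ ^ 2 := by positivity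
    have h3 := (le_abs_self _).trans ((abs_coord_le y i).trans hy)
    have h4 := cP_le_exp n ht hl.le
    calc _ ≤ ((1 / (2 * π * t)) ^ ((n : ℝ) / 2) * exp (-(t * (n / 2)) * l)) *
          rexp (-t - x i + 2) := by
          refine mul_le_mul h4 (exp_le_exp.2 (by linarith)) (exp_pos _).le (by positivity)
      _ = _ := by ring

/-- integrand in the triple integral -/
def PhiI {n m : ℕ} (i : Fin n) (g : EuclideanSpace ℝ (Fin n) → ℝ)
    (h : 𝓢(EuclideanSpace ℝ (Fin m), ℂ)) (ε t : ℝ) (x : Ep n m) (y : Ep n m)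
    (lam : EuclideanSpace ℝ (Fin m)) : ℂ :=
  ((g y.1 * gker i 0 t (cP n t ‖lam‖) (cA t ‖lam‖) (cB t ‖lam‖) x.1 y.1 : ℝ) : ℂ) *
   (h (ε • y.2) * Complex.exp (-Complex.I * ((dotp lam (x.2 - y.2) : ℝ) : ℂ)))

theorem PhiI_measurable {n m : ℕ} (i : Fin n) (g : EuclideanSpace ℝ (Fin n) → ℝ)
    (hgc : Continuous g)
    (h : 𝓢(EuclideanSpace ℝ (Fin m), ℂ)) (ε t : ℝ) (x : Ep n m) :
    Measurable fun z : Ep n m × EuclideanSpace ℝ (Fin m) => PhiI i g h ε t x z.1 z.2 := by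
  unfold PhiI
  have h1 : Measurable fun z : Ep n m × EuclideanSpace ℝ (Fin m) => (t, ‖z.2‖) := by fun_prop
  have hker : Measurable fun z : Ep n m × EuclideanSpace ℝ (Fin m) =>
      gker i 0 t (cP n t ‖z.2‖) (cA t ‖z.2‖) (cB t ‖z.2‖) x.1 z.1.1 :=
    measurable_gker i 0 _ _ _ _ _ _ measurable_const ((measurable_cP n).comp h1)
      (measurable_cA.comp h1) (measurable_cB.comp h1) measurable_const
      (measurable_fst.comp measurable_fst)
  refine Measurable.mul (Complex.measurable_ofReal.comp (Measurable.mul ?_ hker)) ?_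
  · exact hgc.measurable.comp (measurable_fst.comp measurable_fst)
  · have hh := h.continuous
    have : Continuous fun z : Ep n m × EuclideanSpace ℝ (Fin m) =>
      h (ε • z.1.2) * Complex.exp (-Complex.I * ((dotp z.2 (x.2 - z.1.2) : ℝ) : ℂ)) := by
      simp only [dotp_eq]
      fun_prop
    exact this.measurable

theorem PhiI_integrable {n m : ℕ} (hn : 0 < n) (i : Fin n) (g : EuclideanSpace ℝ (Fin n) → ℝ)
    (hgc : Continuous g) (hgs : HasCompactSupport g) (hg : ∀ y, 2 ≤ ‖y‖ → g y = 0)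
    (h : 𝓢(EuclideanSpace ℝ (Fin m), ℂ)) {ε t : ℝ} (hε : 0 < ε) (ht : 0 < t) (x : Ep n m) :
    Integrable (Function.uncurry (PhiI i g h ε t x))
      ((volume : Measure (Ep n m)).prod volume) := by
  set c : ℝ := (1 / (2 * π * t)) ^ ((n : ℝ) / 2) * rexp (-t - x.1 i + 2) with hc
  have hc0 : 0 ≤ c := by positivity
  have i1 : Integrable g := hgc.integrable_of_hasCompactSupport hgs
  have i2 : Integrable fun y : EuclideanSpace ℝ (Fin m) => ‖h (ε • y)‖ :=
    ((h.integrable (μ := volume)).comp_smul hε.ne').norm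
  have i3 : Integrable fun ν : EuclideanSpace ℝ (Fin m) => exp (-(t * (n / 2)) * ‖ν‖) :=
    integrable_exp_neg_norm m (by positivity)
  have i4 := ((i1.abs.mul_prod i2).mul_prod i3).const_mul c
  refine i4.mono' (PhiI_measurable i g hgc h ε t x).aestronglyMeasurable
    (Eventually.of_forall fun z => ?_)
  have e1 : -Complex.I * ((dotp z.2 (x.2 - z.1.2) : ℝ) : ℂ) =
    ((-(dotp z.2 (x.2 - z.1.2)) : ℝ) : ℂ) * Complex.I := by push_cast; ring
  rw [Function.uncurry, PhiI, norm_mul, norm_mul, e1, Complex.norm_exp_ofReal_mul_I, mul_one,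
    Complex.norm_real, norm_mul, Real.norm_eq_abs, Real.norm_eq_abs]
  by_cases hz : 2 ≤ ‖z.1.1‖
  · rw [hg _ hz]; simp
  · have h1 := gker0_le hn i ht (norm_nonneg z.2) x.1 z.1.1 (by linarith)
    rw [← hc] at h1
    calc _ ≤ |g z.1.1| * (c * rexp (-(t * (n / 2)) * ‖z.2‖)) * ‖h (ε • z.1.2)‖ := by gcongr
      _ = _ := by ring

theorem heat_formula {n m : ℕ} (hn : 0 < n) (i : Fin n) (g : EuclideanSpace ℝ (Fin n) → ℝ)
    (hgc : Continuous g) (hgs : HasCompactSupport g) (hg : ∀ y, 2 ≤ ‖y‖ → g y = 0)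
    (h : 𝓢(EuclideanSpace ℝ (Fin m), ℂ)) {ε t : ℝ} (hε : 0 < ε) (hε1 : ε ≤ 1) (ht : 0 < t)
    (x : Ep n m) :
    heatOp (EuclideanSpace.single i 1) t (ftest g h ε) x =
      ∫ z, integ i g h ε 0 t x.1 (ε • x.2) z := by
  set cm : ℂ := ((((2 * π) ^ m)⁻¹ : ℝ) : ℂ) with hcm
  have s1 : heatOp (EuclideanSpace.single i 1) t (ftest g h ε) x =
      ∫ y : Ep n m, cm * ∫ lam, PhiI i g h ε t x y lam := by
    unfold heatOp
    congr 1
    ext y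
    rw [driftH, grushinH, ftest, ← hcm]
    have : ∀ lam, PhiI i g h ε t x y lam =
      (((rexp (-‖EuclideanSpace.single i (1 : ℝ)‖ ^ 2 * t) *
        rexp (-dotp (EuclideanSpace.single i 1) (x.1 + y.1)) *
      rexp (2 * dotp (EuclideanSpace.single i 1) y.1) * g y.1 : ℝ) : ℂ) * h (ε • y.2)) *
       (((hermiteK n t lam x.1 y.1 : ℝ) : ℂ) *
      Complex.exp (-Complex.I * ((dotp lam (x.2 - y.2) : ℝ) : ℂ))) := by
      intro lam
      rw [PhiI, ← hermite_gker]
      push_cast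
      ring
    simp only [this]
    rw [integral_const_mul]
    push_cast
    ring
  rw [s1, integral_const_mul, integral_integral_swap (PhiI_integrable hn i g hgc hgs hg h hε ht x)]
  have s2 : ∀ lam, ∫ y : Ep n m, PhiI i g h ε t x y lam =
      (∫ y, ((g y * gker i 0 t (cP n t ‖lam‖) (cA t ‖lam‖) (cB t ‖lam‖) x.1 y : ℝ) : ℂ)) *
      ∫ y, (h (ε • y) * Complex.exp (-Complex.I * ((dotp lam (x.2 - y) : ℝ) : ℂ))) := by
    intro lam
    exact integral_prod_mul (μ := volume) (ν := volume)
      (fun y => ((g y * gker i 0 t (cP n t ‖lam‖) (cA t ‖lam‖) (cB t ‖lam‖) x.1 y : ℝ) : ℂ))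
      (fun y => (h (ε • y) * Complex.exp (-Complex.I * ((dotp lam (x.2 - y) : ℝ) : ℂ))))
  have s3 := Measure.integral_comp_smul_of_nonneg volume
    (fun lam => ∫ y : Ep n m, PhiI i g h ε t x y lam) ε (hR := hε.le)
  rw [finrank_euclideanSpace_fin] at s3
  have s4 : ∫ lam, ∫ y : Ep n m, PhiI i g h ε t x y lam =
      ((ε ^ m : ℝ) : ℂ) * ∫ ν, ∫ y : Ep n m, PhiI i g h ε t x y (ε • ν) := by
    rw [s3, Complex.real_smul, ← mul_assoc, ← Complex.ofReal_mul, mul_inv_cancel₀ (by positivity)]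
    simp
  rw [s4]
  have s5 : ∀ ν, ∫ y : Ep n m, PhiI i g h ε t x y (ε • ν) = (cm⁻¹ * (((ε ^ m)⁻¹ : ℝ) : ℂ)) *
      ∫ y, integ i g h ε 0 t x.1 (ε • x.2) (ν, y) := by
    intro ν
    have hcm0 : cm ≠ 0 := by
      rw [hcm, Complex.ofReal_ne_zero]; positivity
    have := integral_hscale h hε ν x.2
    rw [← hcm] at this
    rw [s2]
    have e2 : ∫ y, (h (ε • y) * Complex.exp (-Complex.I * ((dotp (ε • ν) (x.2 - y) : ℝ) : ℂ))) =
      cm⁻¹ * ((((ε ^ m)⁻¹ : ℝ) : ℂ) * WW h ν (ε • x.2)) := by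
      rw [← this, ← mul_assoc, inv_mul_cancel₀ hcm0, one_mul]
    rw [e2, norm_smul, Real.norm_of_nonneg hε.le]
    simp only [integ]
    rw [integral_const_mul]
    ring
  simp only [s5]
  rw [integral_const_mul]
  have s6 := integral_prod (μ := (volume : Measure (EuclideanSpace ℝ (Fin m))))
    (ν := (volume : Measure (EuclideanSpace ℝ (Fin n))))
    (integ i g h ε 0 t x.1 (ε • x.2)) (integ_integrable hn i 0 g hgc hgs hg h hε hε1 ht x.1 _)
  rw [← s6]
  have hcm0 : cm ≠ 0 := by
      rw [hcm, Complex.ofReal_ne_zero]; positivity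
  have he : ((ε ^ m : ℝ) : ℂ) * (((ε ^ m)⁻¹ : ℝ) : ℂ) = 1 := by
    rw [← Complex.ofReal_mul, mul_inv_cancel₀ (by positivity)]; simp
  have alg : ∀ a b c d J : ℂ, b * c = 1 → a * d = 1 → c * (a * ((b * d) * J)) = J := by
    intro a b c d J h1 h2
    calc _ = (b * c) * (a * d) * J := by ring
      _ = J := by rw [h1, h2]; ring
  exact alg _ _ _ _ _ (inv_mul_cancel₀ hcm0) he

theorem heat_deriv_formula {n m : ℕ} (hn : 0 < n) (i : Fin n) (g : EuclideanSpace ℝ (Fin n) → ℝ)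
    (hgc : Continuous g) (hgs : HasCompactSupport g) (hg : ∀ y, 2 ≤ ‖y‖ → g y = 0)
    (h : 𝓢(EuclideanSpace ℝ (Fin m), ℂ)) {ε t : ℝ} (hε : 0 < ε) (hε1 : ε ≤ 1) (ht : 0 < t) (k : ℕ) :
    ∀ x : Ep n m, (pdx1 i)^[k] (heatOp (EuclideanSpace.single i 1) t (ftest g h ε)) x =
      ∫ z, integ i g h ε k t x.1 (ε • x.2) z := by
  induction k with
  | zero => intro x; exact heat_formula hn i g hgc hgs hg h hε hε1 ht x
  | succ k ih =>
    intro x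
    rw [Function.iterate_succ', Function.comp_apply, pdx1]
    simp only [ih]
    exact (integ_hasDerivAt hn i k g hgc hgs hg h hε hε1 ht x.1 (ε • x.2)).deriv

open scoped FourierTransform SchwartzMap

def glim {n : ℕ} (i : Fin n) (k : ℕ) (t : ℝ) (x y : EuclideanSpace ℝ (Fin n)) : ℝ :=
  gker i k t ((1 / (4 * π * t)) ^ ((n : ℝ) / 2)) (1 / (4 * t)) 0 x y

def Dt (n k : ℕ) (R t : ℝ) : ℝ := (1 + 1 / t) ^ k * ((1 / (4 * π * t)) ^ ((n : ℝ) / 2) *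
      exp (-t + 2 * R - 1 / t))

theorem Dt_integrable (n : ℕ) {k : ℕ} (hk : 1 ≤ k) (R : ℝ) :
    IntegrableOn (fun t : ℝ => t ^ ((k : ℝ) / 2 - 1) * Dt n k R t) (Ioi 0) := by
  have hk' : 0 < (k : ℝ) / 2 := by positivity
  have h1 := (Real.GammaIntegral_convergent hk').const_mul (((k + n).factorial : ℝ) * exp (1 + 2 * R))
  refine h1.mono' ?_ ?_
  · unfold Dt
    exact (by fun_prop : Measurable fun t : ℝ => t ^ ((k : ℝ) / 2 - 1) * ((1 + 1 / t) ^ k *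
      ((1 / (4 * π * t)) ^ ((n : ℝ) / 2) * exp (-t + 2 * R - 1 / t)))).aestronglyMeasurable
  · refine (ae_restrict_iff' measurableSet_Ioi).2 (Eventually.of_forall fun t ht => ?_)
    have ht : 0 < t := ht
    rw [Real.norm_of_nonneg (by unfold Dt; positivity)]
    have a1 : (1 / (4 * π * t)) ^ ((n : ℝ) / 2) ≤ (1 + 1 / t) ^ n := by
      have b1 : 1 / (4 * π * t) ≤ 1 + 1 / t := by
        have : 1 / (4 * π * t) ≤ 1 / t := by
          apply one_div_le_one_div_of_le ht
          have := pi_gt_three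
          nlinarith
        linarith
      calc (1 / (4 * π * t)) ^ ((n : ℝ) / 2) ≤ (1 + 1 / t) ^ ((n : ℝ) / 2) :=
            rpow_le_rpow (by positivity) b1 (by positivity)
        _ ≤ (1 + 1 / t) ^ (n : ℝ) := by
            apply rpow_le_rpow_of_exponent_le
            · have : 0 < 1 / t := by positivity
              linarith
            · have : (0 : ℝ) ≤ n := by positivity
              linarith
        _ = _ := rpow_natCast _ _
    have a2 : (1 + 1 / t) ^ (k + n) ≤ ((k + n).factorial : ℝ) * exp (1 + 1 / t) := by
      have := Real.pow_div_factorial_le_exp (1 + 1 / t) (by positivity) (k + n)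
      rw [div_le_iff₀ (by positivity)] at this
      linarith
    have a3 : Dt n k R t ≤ ((k + n).factorial : ℝ) * exp (1 + 2 * R) * exp (-t) := by
      unfold Dt
      calc _ ≤ (1 + 1 / t) ^ k * ((1 + 1 / t) ^ n * exp (-t + 2 * R - 1 / t)) := by gcongr
        _ = (1 + 1 / t) ^ (k + n) * exp (-t + 2 * R - 1 / t) := by rw [pow_add]; ring
        _ ≤ (((k + n).factorial : ℝ) * exp (1 + 1 / t)) * exp (-t + 2 * R - 1 / t) := by gcongr
        _ = _ := by
          rw [mul_assoc, mul_assoc, ← exp_add, ← exp_add]; congr 2; ring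
    calc _ ≤ t ^ ((k : ℝ) / 2 - 1) * (((k + n).factorial : ℝ) * exp (1 + 2 * R) * exp (-t)) := by
          gcongr
      _ = _ := by ring

theorem dist_lower {n : ℕ} (i : Fin n) {x y : EuclideanSpace ℝ (Fin n)} (hx : 4 ≤ x i)
    (hy : ‖y‖ ≤ 2) {t : ℝ} (ht : 0 < t) : 1 / t ≤ 1 / (4 * t) * ‖x - y‖ ^ 2 := by
  have h1 := (le_abs_self _).trans ((abs_coord_le y i).trans hy)
  have h2 := (le_abs_self _).trans (abs_coord_le (x - y) i)
  rw [PiLp.sub_apply] at h2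
  have h3 : 4 ≤ ‖x - y‖ ^ 2 := by nlinarith
  calc 1 / t = 1 / (4 * t) * 4 := by field_simp
    _ ≤ _ := by gcongr

theorem integ_bound2 {n m : ℕ} (hn : 0 < n) (i : Fin n) (k : ℕ) : ∃ c : ℝ, 0 ≤ c ∧
    ∀ (g : EuclideanSpace ℝ (Fin n) → ℝ) (_ : ∀ y, 2 ≤ ‖y‖ → g y = 0)
    (h : 𝓢(EuclideanSpace ℝ (Fin m), ℂ)) (ε t R : ℝ) (_ : 0 < ε) (_ : ε ≤ 1) (_ : 0 < t)
    (_ : 2 ≤ R) (x' : EuclideanSpace ℝ (Fin n)) (_ : ‖x'‖ ≤ R) (_ : 4 ≤ x' i)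
    (ξ : EuclideanSpace ℝ (Fin m))
    (z : EuclideanSpace ℝ (Fin m) × EuclideanSpace ℝ (Fin n)),
    ‖integ i g h ε k t x' ξ z‖ ≤ c * Dt n k R t *
      ((R * (1 + ‖z.1‖)) ^ k * ‖WW h z.1 ξ‖ * |g z.2|) := by
  obtain ⟨c, hc, hb⟩ := integ_bound (m := m) hn i k
  refine ⟨c, hc, ?_⟩
  intro g hg h ε t R hε hε1 ht hR x' hx hxi ξ z
  refine (hb g hg h ε t R hε hε1 ht hR x' hx ξ z).trans ?_
  by_cases hz : 2 ≤ ‖z.2‖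
  · rw [hg _ hz]; simp
  · have := dist_lower i hxi (not_le.1 hz).le ht
    unfold Dt
    gcongr

theorem glim_bound {n : ℕ} (i : Fin n) (k : ℕ) : ∃ c : ℝ, 0 ≤ c ∧
    ∀ (g : EuclideanSpace ℝ (Fin n) → ℝ) (_ : ∀ y, 2 ≤ ‖y‖ → g y = 0)
    (t R : ℝ) (_ : 0 < t)
    (_ : 2 ≤ R) (x' : EuclideanSpace ℝ (Fin n)) (_ : ‖x'‖ ≤ R) (_ : 4 ≤ x' i)
    (y : EuclideanSpace ℝ (Fin n)),
    ‖g y * glim i k t x' y‖ ≤ c * R ^ k * Dt n k R t * |g y| := by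
  obtain ⟨c, hc, hb⟩ := gker_bound i k
  refine ⟨c, hc, ?_⟩
  intro g hg t R ht hR x' hx hxi y
  by_cases hz : 2 ≤ ‖y‖
  · rw [hg _ hz]; simp
  · have h0 := dist_lower i hxi (not_le.1 hz).le ht
    have h1 := hb t 0 _ _ _ R ht le_rfl (by linarith) (goodC_lim n ht le_rfl) x' y hx (by linarith)
    rw [norm_mul, Real.norm_eq_abs, Real.norm_eq_abs, mul_comm]
    refine mul_le_mul_of_nonneg_right ?_ (abs_nonneg _)
    refine h1.trans ?_
    have e : c * (R * (1 + 1 / t) * (1 + 0)) ^ k = c * R ^ k * (1 + 1 / t) ^ k := by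
      rw [add_zero, mul_one, mul_pow]; ring
    rw [e]
    unfold Dt
    have : 0 < R := by linarith
    calc _ ≤ c * R ^ k * (1 + 1 / t) ^ k *
         ((1 / (4 * π * t)) ^ ((n : ℝ) / 2) * exp (-t + 2 * R - 1 / t)) := by gcongr
      _ = _ := by ring

theorem measurable_glim {n : ℕ} (i : Fin n) (k : ℕ) (x : EuclideanSpace ℝ (Fin n)) :
    Measurable fun z : ℝ × EuclideanSpace ℝ (Fin n) => glim i k z.1 x z.2 := by
  unfold glim
  exact measurable_gker i k _ _ _ _ _ _ measurable_fst
    (by fun_prop : Measurable fun z : ℝ × EuclideanSpace ℝ (Fin n) =>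
      (1 / (4 * π * z.1)) ^ ((n : ℝ) / 2))
    (by fun_prop : Measurable fun z : ℝ × EuclideanSpace ℝ (Fin n) => 1 / (4 * z.1))
    measurable_const measurable_const measurable_snd

theorem measurable_gglim {n : ℕ} (i : Fin n) (k : ℕ) (g : EuclideanSpace ℝ (Fin n) → ℝ)
    (hgc : Continuous g) (x : EuclideanSpace ℝ (Fin n)) :
    Measurable fun z : ℝ × EuclideanSpace ℝ (Fin n) => g z.2 * glim i k z.1 x z.2 :=
  (hgc.measurable.comp measurable_snd).mul (measurable_glim i k x)

theorem gglim_integrable {n : ℕ} (i : Fin n) (k : ℕ) (g : EuclideanSpace ℝ (Fin n) → ℝ)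
    (hgc : Continuous g) (hgs : HasCompactSupport g) (hg : ∀ y, 2 ≤ ‖y‖ → g y = 0)
    (x : EuclideanSpace ℝ (Fin n)) (hx : 4 ≤ x i) {t : ℝ} (ht : 0 < t) :
    Integrable fun y => g y * glim i k t x y := by
  obtain ⟨c, hc, hb⟩ := glim_bound i k
  have hR : 2 ≤ 2 + ‖x‖ := by have := norm_nonneg x; linarith
  refine ((hgc.integrable_of_hasCompactSupport hgs).abs.const_mul
    (c * (2 + ‖x‖) ^ k * Dt n k (2 + ‖x‖) t)).mono' ?_
    (Eventually.of_forall fun y => hb g hg t (2 + ‖x‖) ht hR x (by linarith) hx y)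
  exact (measurable_comp_pair _ (measurable_gglim i k g hgc x) t).aestronglyMeasurable

theorem lim_integrable {n : ℕ} (i : Fin n) {k : ℕ} (hk : 1 ≤ k) (g : EuclideanSpace ℝ (Fin n) → ℝ)
    (hgc : Continuous g) (hgs : HasCompactSupport g) (hg : ∀ y, 2 ≤ ‖y‖ → g y = 0)
    (x : EuclideanSpace ℝ (Fin n)) (hx : 4 ≤ x i) :
    IntegrableOn (fun t : ℝ => t ^ ((k : ℝ) / 2 - 1) * ∫ y, g y * glim i k t x y) (Ioi 0) := by
  obtain ⟨c, hc, hb⟩ := glim_bound i k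
  have hR : 2 ≤ 2 + ‖x‖ := by have := norm_nonneg x; linarith
  have h1 := (Dt_integrable n hk (2 + ‖x‖)).const_mul (c * (2 + ‖x‖) ^ k * ∫ y, |g y|)
  refine h1.mono' ?_ ?_
  · have h2 : StronglyMeasurable fun t : ℝ => ∫ y, g y * glim i k t x y :=
      (measurable_gglim i k g hgc x).stronglyMeasurable.integral_prod_right'
    exact ((by fun_prop : Measurable fun t : ℝ => t ^ ((k : ℝ) / 2 - 1)).stronglyMeasurable.mul
      h2).aestronglyMeasurable
  · refine (ae_restrict_iff' measurableSet_Ioi).2 (Eventually.of_forall fun t ht => ?_)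
    have ht : 0 < t := ht
    rw [norm_mul, Real.norm_of_nonneg (by positivity)]
    have h2 : ‖∫ y, g y * glim i k t x y‖ ≤ ∫ y, c * (2 + ‖x‖) ^ k * Dt n k (2 + ‖x‖) t * |g y| :=
      norm_integral_le_of_norm_le ((hgc.integrable_of_hasCompactSupport hgs).abs.const_mul _)
        (Eventually.of_forall fun y => hb g hg t (2 + ‖x‖) ht hR x (by linarith) hx y)
    rw [integral_const_mul] at h2
    calc _ ≤ t ^ ((k : ℝ) / 2 - 1) * (c * (2 + ‖x‖) ^ k * Dt n k (2 + ‖x‖) t * ∫ y, |g y|) := by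
          gcongr
      _ = _ := by ring

def epsj (j : ℕ) : ℝ := 1 / ((j : ℝ) + 1)

theorem epsj_pos (j : ℕ) : 0 < epsj j := by unfold epsj; positivity
theorem epsj_le (j : ℕ) : epsj j ≤ 1 := by
  unfold epsj
  rw [div_le_one (by positivity)]
  have : (0 : ℝ) ≤ j := by positivity
  linarith
open Topology in
theorem epsj_tendsto : Tendsto epsj atTop (𝓝 0) := tendsto_one_div_add_atTop_nhds_zero_nat

open Topology in
theorem inner_limit {n m : ℕ} (hn : 0 < n) (hm : 1 ≤ m) (i : Fin n) (k : ℕ)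
    (g : EuclideanSpace ℝ (Fin n) → ℝ)
    (hgc : Continuous g) (hgs : HasCompactSupport g) (hg : ∀ y, 2 ≤ ‖y‖ → g y = 0)
    (h : 𝓢(EuclideanSpace ℝ (Fin m), ℂ)) (x : EuclideanSpace ℝ (Fin n)) (hx : 4 ≤ x i)
    (ξ : EuclideanSpace ℝ (Fin m)) {t : ℝ} (ht : 0 < t) :
    Tendsto (fun j => ∫ z, integ i g h (epsj j) k t x ξ z) atTop
      (𝓝 (h ξ * ((∫ y, g y * glim i k t x y : ℝ) : ℂ))) := by
  have e1 : h ξ * ((∫ y, g y * glim i k t x y : ℝ) : ℂ) =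
      ∫ z : EuclideanSpace ℝ (Fin m) × EuclideanSpace ℝ (Fin n),
        WW h z.1 ξ * ((g z.2 * glim i k t x z.2 : ℝ) : ℂ) := by
    rw [← WW_integral h ξ, ← integral_complex_ofReal]
    exact (integral_prod_mul (μ := volume) (ν := volume) (fun ν => WW h ν ξ)
      (fun y => ((g y * glim i k t x y : ℝ) : ℂ))).symm
  rw [e1]
  obtain ⟨c, hc, hb⟩ := integ_bound2 (m := m) hn i k
  have hR : 2 ≤ 2 + ‖x‖ := by have := norm_nonneg x; linarith
  refine tendsto_integral_of_dominated_convergence _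
    (fun j => (measurable_integ' i g hgc h (epsj j) k t x ξ).aestronglyMeasurable)
    ((integ_dom_integrable g hgc hgs h k (2 + ‖x‖) ξ).const_mul (c * Dt n k (2 + ‖x‖) t))
    (fun j => Eventually.of_forall fun z => hb g hg h (epsj j) t _ (epsj_pos j) (epsj_le j) ht hR x
      (by linarith) hx ξ z) ?_
  have : Nonempty (Fin m) := ⟨⟨0, hm⟩⟩
  have : Nontrivial (EuclideanSpace ℝ (Fin m)) := inferInstance
  have hae : ∀ᵐ ν : EuclideanSpace ℝ (Fin m), ν ≠ 0 := compl_mem_ae_iff.2 (measure_singleton 0)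
  have hae2 : ∀ᵐ z : EuclideanSpace ℝ (Fin m) × EuclideanSpace ℝ (Fin n), z.1 ≠ 0 :=
    Measure.quasiMeasurePreserving_fst.ae hae
  filter_upwards [hae2] with z hz
  simp only [integ]
  refine Tendsto.const_mul _ ((Complex.continuous_ofReal.tendsto _).comp (Tendsto.const_mul _ ?_))
  refine (gker_tendsto i k ht x z.2).comp (tendsto_nhdsWithin_iff.2 ⟨?_, ?_⟩)
  · simpa using epsj_tendsto.mul_const ‖z.1‖
  · exact Eventually.of_forall fun j => mul_pos (epsj_pos j) (norm_pos_iff.2 hz)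

open Topology in
theorem riesz_limit {n m : ℕ} (hn : 0 < n) (hm : 1 ≤ m) (i : Fin n) {k : ℕ} (hk : 1 ≤ k)
    (g : EuclideanSpace ℝ (Fin n) → ℝ)
    (hgc : Continuous g) (hgs : HasCompactSupport g) (hg : ∀ y, 2 ≤ ‖y‖ → g y = 0)
    (h : 𝓢(EuclideanSpace ℝ (Fin m), ℂ)) (x : EuclideanSpace ℝ (Fin n)) (hx : 4 ≤ x i)
    (ξ : EuclideanSpace ℝ (Fin m)) :
    Tendsto (fun j => rieszPd1 (EuclideanSpace.single i 1) i k (ftest g h (epsj j))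
      ((x, (epsj j)⁻¹ • ξ) : Ep n m)) atTop
      (𝓝 ((((Real.Gamma ((k : ℝ) / 2))⁻¹ : ℝ) : ℂ) * (h ξ *
        ((∫ t in Ioi (0 : ℝ), t ^ ((k : ℝ) / 2 - 1) * ∫ y, g y * glim i k t x y : ℝ) : ℂ)))) := by
  have e1 : ∀ j, rieszPd1 (EuclideanSpace.single i 1) i k (ftest g h (epsj j))
      ((x, (epsj j)⁻¹ • ξ) : Ep n m) = (((Real.Gamma ((k : ℝ) / 2))⁻¹ : ℝ) : ℂ) *
      ∫ t in Ioi (0 : ℝ), ((t ^ ((k : ℝ) / 2 - 1) : ℝ) : ℂ) *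
        ∫ z, integ i g h (epsj j) k t x ξ z := by
    intro j
    rw [rieszPd1]
    congr 1
    refine setIntegral_congr_fun measurableSet_Ioi fun t ht => ?_
    rw [heat_deriv_formula hn i g hgc hgs hg h (epsj_pos j) (epsj_le j) ht k, smul_smul,
      mul_inv_cancel₀ (epsj_pos j).ne', one_smul]
  simp only [e1]
  refine Tendsto.const_mul _ ?_
  have e2 : h ξ * ((∫ t in Ioi (0 : ℝ), t ^ ((k : ℝ) / 2 - 1) *
      ∫ y, g y * glim i k t x y : ℝ) : ℂ) =
      ∫ t in Ioi (0 : ℝ), ((t ^ ((k : ℝ) / 2 - 1) : ℝ) : ℂ) *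
        (h ξ * ((∫ y, g y * glim i k t x y : ℝ) : ℂ)) := by
    rw [← integral_complex_ofReal, ← integral_const_mul]
    congr 1
    ext t
    push_cast
    ring
  rw [e2]
  obtain ⟨c, hc, hb⟩ := integ_bound2 (m := m) hn i k
  have hR : 2 ≤ 2 + ‖x‖ := by have := norm_nonneg x; linarith
  set M : ℝ := ∫ z : EuclideanSpace ℝ (Fin m) × EuclideanSpace ℝ (Fin n),
      ((2 + ‖x‖) * (1 + ‖z.1‖)) ^ k * ‖WW h z.1 ξ‖ * |g z.2| with hM
  have hdom := integ_dom_integrable g hgc hgs h k (2 + ‖x‖) ξ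
  refine tendsto_integral_of_dominated_convergence _ ?_
    ((Dt_integrable n hk (2 + ‖x‖)).const_mul (c * M)) ?_ ?_
  · intro j
    have h2 : StronglyMeasurable fun t : ℝ => ∫ z, integ i g h (epsj j) k t x ξ z :=
      (measurable_integ i g hgc h (epsj j) k x ξ).stronglyMeasurable.integral_prod_right'
    exact ((by fun_prop : Measurable fun t : ℝ =>
      ((t ^ ((k : ℝ) / 2 - 1) : ℝ) : ℂ)).stronglyMeasurable.mul h2).aestronglyMeasurable
  · intro j
    refine (ae_restrict_iff' measurableSet_Ioi).2 (Eventually.of_forall fun t ht => ?_)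
    have ht : 0 < t := ht
    rw [norm_mul, Complex.norm_real, Real.norm_of_nonneg (by positivity)]
    have h2 := norm_integral_le_of_norm_le (hdom.const_mul (c * Dt n k (2 + ‖x‖) t))
        (Eventually.of_forall fun z => hb g hg h (epsj j) t _ (epsj_pos j) (epsj_le j) ht hR x
      (by linarith) hx ξ z)
    rw [integral_const_mul, ← hM] at h2
    calc _ ≤ t ^ ((k : ℝ) / 2 - 1) * (c * Dt n k (2 + ‖x‖) t * M) := by gcongr
      _ = _ := by ring
  · refine (ae_restrict_iff' measurableSet_Ioi).2 (Eventually.of_forall fun t ht => ?_)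
    exact (inner_limit hn hm i k g hgc hgs hg h x hx ξ ht).const_mul _

open scoped FourierTransform SchwartzMap

/-- the positive kernel -/
def Sk {n : ℕ} (i : Fin n) (k : ℕ) (t : ℝ) (x y : EuclideanSpace ℝ (Fin n)) : ℝ :=
  qP k (1 / (4 * t)) (gL i (1 / (4 * t)) 0 x y) *
    gphi i t ((1 / (4 * π * t)) ^ ((n : ℝ) / 2)) (1 / (4 * t)) 0 x y

theorem glim_Sk {n : ℕ} (i : Fin n) (k : ℕ) (t : ℝ) (x y : EuclideanSpace ℝ (Fin n)) :
    glim i k t x y = (-1) ^ k * Sk i k t x y := rfl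

theorem Sk_lower {n : ℕ} (i : Fin n) (k : ℕ) {t : ℝ} (ht : 0 < t) (x y : EuclideanSpace ℝ (Fin n))
    (hu : (k : ℝ) ≤ x i - y i) :
    (1 / 2) ^ k * gphi i t ((1 / (4 * π * t)) ^ ((n : ℝ) / 2)) (1 / (4 * t)) 0 x y ≤
      Sk i k t x y := by
  unfold Sk
  have hk0 : (0 : ℝ) ≤ k := by positivity
  have hL : gL i (1 / (4 * t)) 0 x y = (x i - y i) / (2 * t) + 1 := by
    unfold gL; field_simp; ring
  set u := x i - y i with hu'
  have hu0 : 0 ≤ u / (2 * t) := div_nonneg (by linarith) (by positivity)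
  rw [hL]
  have h1 : (1 / 2 : ℝ) ^ k ≤ qP k (1 / (4 * t)) (u / (2 * t) + 1) := by
    refine le_trans ?_ (qP_lower_pow _ _ (by linarith) (by positivity) k ?_)
    · gcongr
      linarith
    · have e1 : 8 * (1 / (4 * t)) * k = 4 * (k / (2 * t)) := by field_simp; ring
      have e2 : (k : ℝ) / (2 * t) ≤ u / (2 * t) := by gcongr
      rw [e1]
      nlinarith [sq_nonneg (u / (2 * t) - 1)]
  refine mul_le_mul_of_nonneg_right h1 ?_
  unfold gphi; positivity

theorem Sk_nonneg {n : ℕ} (i : Fin n) (k : ℕ) {t : ℝ} (ht : 0 < t) (x y : EuclideanSpace ℝ (Fin n))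
    (hu : (k : ℝ) ≤ x i - y i) : 0 ≤ Sk i k t x y := by
  refine le_trans ?_ (Sk_lower i k ht x y hu)
  unfold gphi; positivity

theorem normsq_le {n : ℕ} (i : Fin n) (x y : EuclideanSpace ℝ (Fin n)) {N : ℝ} (hN : 0 ≤ N)
    (hx : ∀ j, j ≠ i → |x j| ≤ N) (hy : ‖y‖ ≤ 1) :
    ‖x - y‖ ^ 2 ≤ (x i - y i) ^ 2 + n * (N + 1) ^ 2 := by
  rw [EuclideanSpace.real_norm_sq_eq]
  calc ∑ j, (x - y) j ^ 2 ≤ ∑ j, ((if j = i then (x i - y i) ^ 2 else 0) + (N + 1) ^ 2) := by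
        refine Finset.sum_le_sum fun j _ => ?_
        rw [PiLp.sub_apply]
        split_ifs with hj
        · subst hj; nlinarith [sq_nonneg (N + 1)]
        · have h1 := abs_le.1 (hx j hj)
          have h2 := abs_le.1 ((abs_coord_le y j).trans hy)
          rw [zero_add]
          apply sq_le_sq'
          · linarith
          · linarith
    _ = _ := by simp [Finset.sum_add_distrib]

theorem gphi_lower {n : ℕ} (i : Fin n) (x y : EuclideanSpace ℝ (Fin n)) {N t : ℝ} (hN : 2 ≤ N)
    (hx : ∀ j, j ≠ i → |x j| ≤ N) (hxi : N ^ 2 ≤ x i) (hxi' : x i ≤ N ^ 2 + 1) (hy : ‖y‖ ≤ 1)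
    (ht : N ^ 2 / 2 ≤ t) (ht' : t ≤ N ^ 2 / 2 + N) :
    (1 / (6 * N)) ^ n * exp (-(2 * N ^ 2) - (12 + 5 * n)) ≤
      gphi i t ((1 / (4 * π * t)) ^ ((n : ℝ) / 2)) (1 / (4 * t)) 0 x y := by
  have hN0 : 0 < N := by linarith
  have ht0 : 0 < t := by nlinarith
  unfold gphi
  have hn0 : (0 : ℝ) ≤ n := by positivity
  refine mul_le_mul ?_ (exp_le_exp.2 ?_) (exp_pos _).le (by positivity)
  · have h1 : (1 / (6 * N)) ^ n = ((1 / (6 * N)) ^ 2) ^ ((n : ℝ) / 2) := by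
      rw [← rpow_natCast, ← rpow_natCast, ← rpow_mul (by positivity)]
      congr 1
      push_cast
      ring
    rw [h1]
    refine rpow_le_rpow (by positivity) ?_ (by positivity)
    rw [one_div_pow]
    apply one_div_le_one_div_of_le (by positivity)
    have h3 : 4 * π ≤ 16 := by linarith [pi_le_four]
    have h4 : t ≤ 2 * N ^ 2 := by nlinarith
    calc 4 * π * t ≤ 16 * (2 * N ^ 2) := by gcongr
      _ ≤ _ := by nlinarith
  · have h1 := normsq_le i x y hN0.le hx hy
    have h2 := abs_le.1 ((abs_coord_le y i).trans hy)
    set u := x i - y i with hu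
    have h3 : 1 / (4 * t) * ‖x - y‖ ^ 2 ≤ 1 / (4 * t) * (u ^ 2 + n * (N + 1) ^ 2) := by gcongr
    have h4 : 1 / (4 * t) * (n * (N + 1) ^ 2) ≤ 5 * n := by
      rw [div_mul_eq_mul_div, one_mul, div_le_iff₀ (by positivity)]
      have : (N + 1) ^ 2 ≤ 20 * t := by nlinarith
      nlinarith
    have h5 : 1 / (4 * t) * u ^ 2 = u - t + 1 / (4 * t) * (u - 2 * t) ^ 2 := by
      field_simp; ring
    have h6 : 1 / (4 * t) * (u - 2 * t) ^ 2 ≤ 8 := by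
      rw [div_mul_eq_mul_div, one_mul, div_le_iff₀ (by positivity)]
      have : (u - 2 * t) ^ 2 ≤ (4 * N) ^ 2 := by
        apply sq_le_sq' <;> nlinarith
      nlinarith
    rw [mul_add] at h3
    nlinarith

theorem J_lower {n : ℕ} (i : Fin n) {k : ℕ} (hk : 2 ≤ k) (g : EuclideanSpace ℝ (Fin n) → ℝ)
    (hgc : Continuous g) (hgs : HasCompactSupport g) (hg : ∀ y, 2 ≤ ‖y‖ → g y = 0)
    (hg0 : ∀ y, 0 ≤ g y) (hg1 : ∀ y, ‖y‖ ≤ 1 → g y = 1)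
    (x : EuclideanSpace ℝ (Fin n)) {N : ℝ} (hN : (k : ℝ) + 2 ≤ N)
    (hx : ∀ j, j ≠ i → |x j| ≤ N) (hxi : N ^ 2 ≤ x i) (hxi' : x i ≤ N ^ 2 + 1) :
    (N / 2) ^ (k - 2) * (((1 / 2) ^ k * ((1 / (6 * N)) ^ n * exp (-(2 * N ^ 2) - (12 + 5 * n)))) *
      volume.real (Metric.closedBall (0 : EuclideanSpace ℝ (Fin n)) 1)) * N ≤
    |∫ t in Ioi (0 : ℝ), t ^ ((k : ℝ) / 2 - 1) * ∫ y, g y * glim i k t x y| := by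
  have hk0 : (0 : ℝ) ≤ k := by positivity
  have hN2 : 2 ≤ N := by linarith
  have hN0 : 0 < N := by linarith
  have hx4 : 4 ≤ x i := by nlinarith
  have hNN : (k : ℝ) + 2 ≤ N ^ 2 := by nlinarith
  have hu : ∀ y : EuclideanSpace ℝ (Fin n), ‖y‖ ≤ 2 → (k : ℝ) ≤ x i - y i := by
    intro y hy
    have := (le_abs_self _).trans ((abs_coord_le y i).trans hy)
    linarith
  have hsg : ((-1 : ℝ) ^ k) * (-1) ^ k = 1 := by rw [← mul_pow]; simp
  have hI : ∀ t, ∫ y, g y * glim i k t x y = (-1) ^ k * ∫ y, g y * Sk i k t x y := by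
    intro t
    rw [← integral_const_mul]
    congr 1
    ext y
    rw [glim_Sk]; ring
  have hI2 : ∀ t, 0 < t → Integrable fun y => g y * Sk i k t x y := by
    intro t ht
    refine ((gglim_integrable i k g hgc hgs hg x hx4 ht).const_mul ((-1) ^ k)).congr
      (Eventually.of_forall fun y => ?_)
    simp only [glim_Sk]
    calc _ = ((-1 : ℝ) ^ k * (-1) ^ k) * (g y * Sk i k t x y) := by ring
      _ = _ := by rw [hsg, one_mul]
  have hpos : ∀ t, 0 < t → ∀ y, 0 ≤ g y * Sk i k t x y := by
    intro t ht y
    by_cases hy : 2 ≤ ‖y‖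
    · rw [hg y hy]; simp
    · exact mul_nonneg (hg0 y) (Sk_nonneg i k ht x y (hu y (not_le.1 hy).le))
  have hint : IntegrableOn (fun t : ℝ => t ^ ((k : ℝ) / 2 - 1) * ∫ y, g y * Sk i k t x y)
      (Ioi 0) := by
    refine ((lim_integrable i (one_le_two.trans hk) g hgc hgs hg x hx4).const_mul ((-1) ^ k)).congr
      (Eventually.of_forall fun t => ?_)
    simp only [hI]
    calc _ = ((-1 : ℝ) ^ k * (-1) ^ k) * (t ^ ((k : ℝ) / 2 - 1) * ∫ y, g y * Sk i k t x y) := by ring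
      _ = _ := by rw [hsg, one_mul]
  have e1 : |∫ t in Ioi (0 : ℝ), t ^ ((k : ℝ) / 2 - 1) * ∫ y, g y * glim i k t x y| =
      |∫ t in Ioi (0 : ℝ), t ^ ((k : ℝ) / 2 - 1) * ∫ y, g y * Sk i k t x y| := by
    have : ∀ t : ℝ, t ^ ((k : ℝ) / 2 - 1) * ∫ y, g y * glim i k t x y = (-1) ^ k *
        (t ^ ((k : ℝ) / 2 - 1) * ∫ y, g y * Sk i k t x y) := by
      intro t; rw [hI]; ring
    simp only [this]
    rw [integral_const_mul, abs_mul]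
    simp
  rw [e1]
  refine le_trans ?_ (le_abs_self _)
  have hsub : Icc (N ^ 2 / 2) (N ^ 2 / 2 + N) ⊆ Ioi (0 : ℝ) := by
    intro t ht
    have : 0 < N ^ 2 / 2 := by positivity
    exact lt_of_lt_of_le this ht.1
  have m1 := setIntegral_mono_set hint ((ae_restrict_iff' measurableSet_Ioi).2
    (Eventually.of_forall fun t (ht : 0 < t) =>
      mul_nonneg (rpow_nonneg ht.le _) (integral_nonneg (hpos t ht)))) hsub.eventuallyLE
  refine le_trans ?_ m1
  have hlow : ∀ t ∈ Icc (N ^ 2 / 2) (N ^ 2 / 2 + N),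
      (N / 2) ^ (k - 2) * (((1 / 2) ^ k * ((1 / (6 * N)) ^ n * exp (-(2 * N ^ 2) - (12 + 5 * n)))) *
      volume.real (Metric.closedBall (0 : EuclideanSpace ℝ (Fin n)) 1)) ≤
      t ^ ((k : ℝ) / 2 - 1) * ∫ y, g y * Sk i k t x y := by
    intro t ht
    have ht0 : 0 < t := hsub ht
    refine mul_le_mul ?_ ?_ (by positivity) (by positivity)
    · have h1 : (N / 2) ^ (k - 2) = ((N / 2) ^ 2) ^ ((k : ℝ) / 2 - 1) := by
        rw [← rpow_natCast, ← rpow_natCast, ← rpow_mul (by positivity)]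
        congr 1
        push_cast [hk]
        ring
      rw [h1]
      refine rpow_le_rpow (by positivity) (by nlinarith [ht.1]) ?_
      have : (2 : ℝ) ≤ k := by exact_mod_cast hk
      linarith
    · refine le_trans ?_ (setIntegral_le_integral (s := Metric.closedBall 0 1) (hI2 t ht0)
        (Eventually.of_forall (hpos t ht0)))
      refine setIntegral_ge_of_const_le_real measurableSet_closedBall
        (measure_closedBall_lt_top.ne) ?_ (hI2 t ht0).integrableOn
      intro y hy
      have hy : ‖y‖ ≤ 1 := by simpa using hy
      rw [hg1 y hy, one_mul]
      refine le_trans ?_ (Sk_lower i k ht0 x y (hu y (by linarith)))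
      gcongr
      exact gphi_lower i x y hN2 hx hxi hxi' hy ht.1 ht.2
  have := setIntegral_ge_of_const_le_real measurableSet_Icc (by simp) hlow (hint.mono_set hsub)
  simpa [hN0.le] using this

open scoped FourierTransform SchwartzMap

theorem continuous_dotp {n : ℕ} (a : EuclideanSpace ℝ (Fin n)) : Continuous fun x => dotp a x := by
  simp only [dotp_eq]; fun_prop

theorem exists_bumps (n m : ℕ) : ∃ (g : EuclideanSpace ℝ (Fin n) → ℝ)
    (h : 𝓢(EuclideanSpace ℝ (Fin m), ℂ)), ContDiff ℝ (⊤ : ℕ∞) g ∧ HasCompactSupport g ∧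
    (∀ y, 2 ≤ ‖y‖ → g y = 0) ∧ (∀ y, 0 ≤ g y) ∧ (∀ y, ‖y‖ ≤ 1 → g y = 1) ∧
    (∀ y, 2 ≤ ‖y‖ → h y = 0) ∧ (∀ y, ‖y‖ ≤ 1 → h y = 1) := by
  let b : ContDiffBump (0 : EuclideanSpace ℝ (Fin n)) := ⟨1, 2, one_pos, one_lt_two⟩
  let b' : ContDiffBump (0 : EuclideanSpace ℝ (Fin m)) := ⟨1, 2, one_pos, one_lt_two⟩
  have hs : HasCompactSupport fun y => ((b' y : ℝ) : ℂ) :=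
    b'.hasCompactSupport.comp_left (g := fun r : ℝ => (r : ℂ)) Complex.ofReal_zero
  have hd : ContDiff ℝ (⊤ : ℕ∞) fun y => ((b' y : ℝ) : ℂ) :=
    Complex.ofRealCLM.contDiff.comp b'.contDiff
  refine ⟨b, hs.toSchwartzMap hd, b.contDiff, b.hasCompactSupport, ?_, fun y => b.nonneg, ?_, ?_, ?_⟩
  · intro y hy
    exact b.zero_of_le_dist (by simpa using hy)
  · intro y hy
    exact b.one_of_mem_closedBall (by simpa using hy)
  · intro y hy
    have : b' y = 0 := b'.zero_of_le_dist (by simpa using hy)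
    change ((b' y : ℝ) : ℂ) = 0
    rw [this]; simp
  · intro y hy
    have : b' y = 1 := b'.one_of_mem_closedBall (by simpa using hy)
    change ((b' y : ℝ) : ℂ) = 1
    rw [this]; simp

theorem ftest_contDiff {n m : ℕ} (g : EuclideanSpace ℝ (Fin n) → ℝ) (hg : ContDiff ℝ (⊤ : ℕ∞) g)
    (h : 𝓢(EuclideanSpace ℝ (Fin m), ℂ)) (ε : ℝ) : ContDiff ℝ (⊤ : ℕ∞) (ftest g h ε) := by
  unfold ftest
  refine ContDiff.mul ?_ ?_
  · exact Complex.ofRealCLM.contDiff.comp (hg.comp contDiff_fst)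
  · exact (h.smooth _).comp (contDiff_snd.const_smul ε)

theorem ftest_supp {n m : ℕ} (g : EuclideanSpace ℝ (Fin n) → ℝ) (hg : ∀ y, 2 ≤ ‖y‖ → g y = 0)
    (h : 𝓢(EuclideanSpace ℝ (Fin m), ℂ)) (hh : ∀ y, 2 ≤ ‖y‖ → h y = 0) {ε : ℝ} (hε : 0 < ε) :
    HasCompactSupport (ftest g h ε : Ep n m → ℂ) := by
  refine HasCompactSupport.intro
    ((isCompact_closedBall (0 : EuclideanSpace ℝ (Fin n)) 2).prod
      (isCompact_closedBall (0 : EuclideanSpace ℝ (Fin m)) (2 / ε))) ?_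
  intro x hx
  rw [Set.mem_prod, not_and_or] at hx
  unfold ftest
  rcases hx with hx | hx
  · rw [hg _ (by simp at hx; exact hx.le)]; simp
  · rw [hh, mul_zero]
    have : 2 / ε < ‖x.2‖ := by simpa using hx
    rw [norm_smul, Real.norm_of_nonneg hε.le]
    rw [div_lt_iff₀ hε] at this
    linarith

def Tsc (n m : ℕ) (r : ℝ) (hr : r ≠ 0) : Ep n m ≃ᵐ Ep n m :=
  MeasurableEquiv.prodCongr (MeasurableEquiv.refl _) (MeasurableEquiv.smul₀ r hr)

theorem map_muG {n m : ℕ} (a : EuclideanSpace ℝ (Fin n)) {r : ℝ} (hr : 0 < r) :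
    Measure.map (Tsc n m r hr.ne') (muG a) = ENNReal.ofReal ((r ^ m)⁻¹) • muG a := by
  have hw : Measurable fun x : EuclideanSpace ℝ (Fin n) =>
      ENNReal.ofReal (Real.exp (2 * dotp a x)) := by
    have := continuous_dotp a
    fun_prop
  have e : (muG a : Measure (Ep n m)) = ((volume : Measure (EuclideanSpace ℝ (Fin n))).withDensity
      fun x => ENNReal.ofReal (Real.exp (2 * dotp a x))).prod volume :=
    (prod_withDensity_left hw).symm
  rw [e]
  have e2 : (⇑(Tsc n m r hr.ne') : Ep n m → Ep n m) = Prod.map id (r • ·) := rfl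
  rw [e2, ← Measure.map_prod_map _ _ measurable_id (measurable_const_smul r), Measure.map_id,
    Measure.map_addHaar_smul _ hr.ne', finrank_euclideanSpace_fin, Measure.prod_smul_right,
    abs_of_pos (by positivity)]

theorem box_volume {n : ℕ} (i : Fin n) {N : ℝ} (hN : 0 < N) :
    volume {x : EuclideanSpace ℝ (Fin n) | (N ^ 2 < x i ∧ x i < N ^ 2 + 1) ∧
      ∀ j, j ≠ i → |x j| < N} = ENNReal.ofReal ((2 * N) ^ (n - 1)) := by
  have e : {x : EuclideanSpace ℝ (Fin n) | (N ^ 2 < x i ∧ x i < N ^ 2 + 1) ∧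
      ∀ j, j ≠ i → |x j| < N} = (WithLp.ofLp (p := 2)) ⁻¹' (Set.pi univ fun j : Fin n =>
        if j = i then Ioo (N ^ 2) (N ^ 2 + 1) else Ioo (-N) N) := by
    ext x
    simp only [Set.mem_ofPred_eq, mem_preimage, Set.mem_pi, mem_univ, true_implies]
    constructor
    · rintro ⟨h1, h2⟩ j
      split_ifs with hj
      · subst hj; exact h1
      · exact abs_lt.1 (h2 j hj)
    · intro h
      refine ⟨by simpa using h i, fun j hj => ?_⟩
      have := h j
      rw [if_neg hj] at this
      exact abs_lt.2 this
  rw [e, (PiLp.volume_preserving_ofLp (Fin n)).measure_preimage]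
  · rw [volume_pi_pi, ← Finset.mul_prod_erase Finset.univ _ (Finset.mem_univ i)]
    rw [Finset.prod_congr rfl (g := fun _ => ENNReal.ofReal (2 * N))]
    · simp [ENNReal.ofReal_pow (by positivity : 0 ≤ 2 * N)]
    · intro j hj
      rw [if_neg (Finset.ne_of_mem_erase hj), Real.volume_Ioo]
      congr 1; ring
  · refine (MeasurableSet.univ_pi fun j => ?_).nullMeasurableSet
    split_ifs <;> exact measurableSet_Ioo

def RegA {n : ℕ} (m : ℕ) (i : Fin n) (N : ℝ) : Set (Ep n m) :=
  {x : EuclideanSpace ℝ (Fin n) | (N ^ 2 < x i ∧ x i < N ^ 2 + 1) ∧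
      ∀ j, j ≠ i → |x j| < N} ×ˢ Metric.ball 0 1

theorem RegA_meas {n : ℕ} (m : ℕ) (i : Fin n) (N : ℝ) : MeasurableSet (RegA m i N) := by
  refine MeasurableSet.prod ?_ measurableSet_ball
  have hc : ∀ j : Fin n, Measurable fun v : EuclideanSpace ℝ (Fin n) => v j := fun j =>
    (by fun_prop : Continuous fun v : EuclideanSpace ℝ (Fin n) => v j).measurable
  have e : {x : EuclideanSpace ℝ (Fin n) | (N ^ 2 < x i ∧ x i < N ^ 2 + 1) ∧
      ∀ j, j ≠ i → |x j| < N} = ({x | N ^ 2 < x i} ∩ {x | x i < N ^ 2 + 1}) ∩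
      ⋂ j, {x | j ≠ i → |x j| < N} := by
    ext x; simp
  rw [e]
  refine ((measurableSet_lt measurable_const (hc i)).inter
    (measurableSet_lt (hc i) measurable_const)).inter (MeasurableSet.iInter fun j => ?_)
  by_cases hj : j = i
  · simp [hj]
  · simp only [ne_eq, hj, not_false_eq_true, true_implies]
    exact measurableSet_lt (continuous_abs.measurable.comp (hc j)) measurable_const

theorem RegA_lower {n : ℕ} (m : ℕ) (i : Fin n) {N : ℝ} (hN : 0 < N) :
    ENNReal.ofReal (exp (2 * N ^ 2)) * (ENNReal.ofReal ((2 * N) ^ (n - 1)) *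
      volume (Metric.ball (0 : EuclideanSpace ℝ (Fin m)) 1)) ≤
      muG (EuclideanSpace.single i 1) (RegA m i N) := by
  rw [muG, withDensity_apply _ (RegA_meas m i N)]
  have hv : volume (RegA m i N) = ENNReal.ofReal ((2 * N) ^ (n - 1)) *
      volume (Metric.ball (0 : EuclideanSpace ℝ (Fin m)) 1) := by
    rw [RegA, Measure.volume_eq_prod, Measure.prod_prod, box_volume i hN]
  rw [← hv, ← setLIntegral_const]
  refine setLIntegral_mono' (RegA_meas m i N) fun x hx => ?_
  refine ENNReal.ofReal_le_ofReal (exp_le_exp.2 ?_)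
  rw [dotp_single]
  have : N ^ 2 < x.1 i := hx.1.1.1
  linarith

open Topology in
theorem fatou_sets {Ω : Type*} [MeasurableSpace Ω] (μ : Measure Ω) (A : Set Ω) (S : ℕ → Set Ω)
    (h : ∀ x ∈ A, ∀ᶠ j in atTop, x ∈ S j) (b : ENNReal) (hb : ∀ j, μ (S j) ≤ b) : μ A ≤ b := by
  have hsub : A ⊆ ⋃ M : ℕ, ⋂ j ≥ M, S j := by
    intro x hx
    obtain ⟨M, hM⟩ := eventually_atTop.1 (h x hx)
    exact mem_iUnion.2 ⟨M, mem_iInter₂.2 hM⟩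
  have hmono : Monotone fun M : ℕ => ⋂ j ≥ M, S j := by
    intro M M' hMM x hx
    exact mem_iInter₂.2 fun j hj => mem_iInter₂.1 hx j (hMM.trans hj)
  refine (measure_mono hsub).trans ?_
  rw [hmono.measure_iUnion]
  refine iSup_le fun M => ?_
  exact (measure_mono fun x hx => mem_iInter₂.1 hx M le_rfl).trans (hb M)

theorem scaled_bound {n m : ℕ} (a : EuclideanSpace ℝ (Fin n)) (g : EuclideanSpace ℝ (Fin n) → ℝ)
    (h : 𝓢(EuclideanSpace ℝ (Fin m), ℂ)) {ε : ℝ} (hε : 0 < ε) (L : Set (Ep n m)) (C s : ENNReal)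
    (hL : muG a L ≤ C * eLpNorm (ftest g h ε) 1 (muG a) / s) :
    muG a (Tsc n m ε⁻¹ (inv_pos.2 hε).ne' ⁻¹' L) ≤
      C * eLpNorm (ftest g h 1) 1 (muG (m := m) a) / s := by
  have hT := map_muG (m := m) a (inv_pos.2 hε)
  set T := Tsc n m ε⁻¹ (inv_pos.2 hε).ne' with hTd
  rw [← MeasurableEquiv.map_apply, hT]
  have e : eLpNorm (ftest g h 1) 1 (muG (m := m) a) =
      ENNReal.ofReal (((ε⁻¹) ^ m)⁻¹) * eLpNorm (ftest g h ε) 1 (muG a) := by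
    rw [eLpNorm_one_eq_lintegral_enorm, eLpNorm_one_eq_lintegral_enorm]
    rw [← smul_eq_mul, ← lintegral_smul_measure, ← hT, lintegral_map_equiv]
    refine lintegral_congr fun x => ?_
    have : ftest g h ε (T x) = ftest g h 1 x := by
      change ((g x.1 : ℝ) : ℂ) * h (ε • ε⁻¹ • x.2) = ((g x.1 : ℝ) : ℂ) * h ((1 : ℝ) • x.2)
      rw [smul_smul, mul_inv_cancel₀ hε.ne']
    rw [this]
  rw [e, Measure.smul_apply, smul_eq_mul]
  calc _ ≤ ENNReal.ofReal (((ε⁻¹) ^ m)⁻¹) * (C * eLpNorm (ftest g h ε) 1 (muG a) / s) := by gcongr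
    _ = _ := by rw [← mul_div_assoc]; congr 1; ring

theorem ftest_norm_lt_top {n m : ℕ} (a : EuclideanSpace ℝ (Fin n))
    (g : EuclideanSpace ℝ (Fin n) → ℝ) (hgd : ContDiff ℝ (⊤ : ℕ∞) g)
    (hg : ∀ y, 2 ≤ ‖y‖ → g y = 0)
    (h : 𝓢(EuclideanSpace ℝ (Fin m), ℂ)) (hh : ∀ y, 2 ≤ ‖y‖ → h y = 0) :
    eLpNorm (ftest g h 1) 1 (muG (m := m) a) < ⊤ := by
  have hc := (ftest_contDiff g hgd h 1).continuous
  have hs := ftest_supp g hg h hh one_pos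
  have hd := continuous_dotp a
  have hw : Continuous fun x : Ep n m => Real.exp (2 * dotp a x.1) := by fun_prop
  have hw' : Continuous fun x : Ep n m => ((Real.exp (2 * dotp a x.1) : ℝ) : ℂ) := by fun_prop
  have hF : Integrable fun x : Ep n m => ((Real.exp (2 * dotp a x.1) : ℝ) : ℂ) * ftest g h 1 x :=
    (hw'.mul hc).integrable_of_hasCompactSupport hs.mul_left
  rw [eLpNorm_one_eq_lintegral_enorm, muG, lintegral_withDensity_eq_lintegral_mul _
    (by fun_prop) (by fun_prop)]
  have := hF.2
  rw [hasFiniteIntegral_iff_enorm] at this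
  refine lt_of_le_of_lt (le_of_eq (lintegral_congr fun x => ?_)) this
  simp only [Pi.mul_apply]
  rw [enorm_mul]
  congr 1
  rw [← ofReal_norm, Complex.norm_real, Real.norm_of_nonneg (exp_pos _).le]

open scoped FourierTransform SchwartzMap

def LB (n k : ℕ) (N : ℝ) : ℝ :=
  (N / 2) ^ (k - 2) * (((1 / 2) ^ k * ((1 / (6 * N)) ^ n * exp (-(2 * N ^ 2) - (12 + 5 * n)))) *
      volume.real (Metric.closedBall (0 : EuclideanSpace ℝ (Fin n)) 1)) * N

theorem vol_cball_pos (n : ℕ) :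
    0 < volume.real (Metric.closedBall (0 : EuclideanSpace ℝ (Fin n)) 1) :=
  ENNReal.toReal_pos (Metric.measure_closedBall_pos _ _ one_pos).ne' measure_closedBall_lt_top.ne

theorem vol_ball_pos (m : ℕ) :
    0 < volume.real (Metric.ball (0 : EuclideanSpace ℝ (Fin m)) 1) :=
  ENNReal.toReal_pos (Metric.measure_ball_pos _ _ one_pos).ne' measure_ball_lt_top.ne

theorem LB_pos (n k : ℕ) {N : ℝ} (hN : 0 < N) : 0 < LB n k N := by
  have := vol_cball_pos n
  unfold LB; positivity

theorem LB_growth (n : ℕ) (hn : 0 < n) {k : ℕ} (hk : 3 ≤ k) : ∃ c : ℝ, 0 < c ∧ ∀ N : ℝ, 2 ≤ N →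
    c * N ≤ exp (2 * N ^ 2) * (2 * N) ^ (n - 1) * LB n k N := by
  have hV := vol_cball_pos n
  set V := volume.real (Metric.closedBall (0 : EuclideanSpace ℝ (Fin n)) 1) with hVd
  refine ⟨1 / 2 * ((1 / 2) ^ k * V * exp (-(12 + 5 * n)) * (2 ^ (n - 1) * (1 / 6) ^ n)),
    by positivity, ?_⟩
  intro N hN
  have hN0 : 0 < N := by linarith
  obtain ⟨q, rfl⟩ : ∃ q, n = q + 1 := ⟨n - 1, by omega⟩
  have h1 : N / 2 ≤ (N / 2) ^ (k - 2) := by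
    refine le_self_pow₀ (by linarith) (by omega)
  have h2 : exp (2 * N ^ 2) * exp (-(2 * N ^ 2) - (12 + 5 * ((q + 1 : ℕ) : ℝ))) =
      exp (-(12 + 5 * ((q + 1 : ℕ) : ℝ))) := by
    rw [← exp_add]; congr 1; ring
  have h3 : (2 * N) ^ q * (1 / (6 * N)) ^ (q + 1) * N = 2 ^ q * (1 / 6) ^ (q + 1) := by
    have : (1 / (6 * N)) ^ (q + 1) = (1 / 6) ^ (q + 1) * ((1 / N) ^ q * (1 / N)) := by
      rw [← pow_succ, ← mul_pow]; congr 1; field_simp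
    rw [this, mul_pow]
    have e2 : N ^ q * (1 / N) ^ q = 1 := by
      rw [← mul_pow, mul_one_div_cancel hN0.ne', one_pow]
    calc _ = 2 ^ q * (1 / 6) ^ (q + 1) * (N ^ q * (1 / N) ^ q) * (N * (1 / N)) := by ring
      _ = _ := by rw [e2, mul_one_div_cancel hN0.ne']; ring
  simp only [LB, Nat.add_sub_cancel, ← hVd]
  calc _ = (N / 2) * ((1 / 2) ^ k * V * exp (-(12 + 5 * ((q + 1 : ℕ) : ℝ))) *
        (2 ^ q * (1 / 6) ^ (q + 1))) := by ring
    _ ≤ (N / 2) ^ (k - 2) * ((1 / 2) ^ k * V * exp (-(12 + 5 * ((q + 1 : ℕ) : ℝ))) *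
        (2 ^ q * (1 / 6) ^ (q + 1))) := by gcongr
    _ = _ := by rw [← h2, ← h3]; ring

theorem key_ineq (n m : ℕ) (hn : 0 < n) (hm : 1 ≤ m) (k : ℕ) (hk : 3 ≤ k) (i : Fin n) (C : ℝ)
    (hC : ∀ f : Ep n m → ℂ, ContDiff ℝ (⊤ : ℕ∞) f → HasCompactSupport f → ∀ s : ℝ, 0 < s →
            muG (EuclideanSpace.single i 1)
                {x : Ep n m | s < ‖rieszPd1 (EuclideanSpace.single i 1) i k f x‖} ≤
              ENNReal.ofReal C * eLpNorm f 1 (muG (EuclideanSpace.single i 1)) /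
                  ENNReal.ofReal s) : ∃ K : ℝ, ∀ N : ℝ, (k : ℝ) + 2 ≤ N →
    exp (2 * N ^ 2) * (2 * N) ^ (n - 1) * LB n k N ≤ K := by
  obtain ⟨g, h, hgd, hgs, hg, hg0, hg1, hh, hh1⟩ := exists_bumps n m
  have hgc := hgd.continuous
  set a : EuclideanSpace ℝ (Fin n) := EuclideanSpace.single i 1 with ha
  have hfin := ftest_norm_lt_top (m := m) a g hgd hg h hh
  set K0 := eLpNorm (ftest g h 1) 1 (muG (m := m) a) with hK0
  have hV := vol_ball_pos m
  have hk0 : (0 : ℝ) < k := by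
    have : 0 < k := by omega
    exact_mod_cast this
  have hΓ : 0 < (Real.Gamma ((k : ℝ) / 2))⁻¹ := inv_pos.2 (Real.Gamma_pos_of_pos (by positivity))
  set Γ := (Real.Gamma ((k : ℝ) / 2))⁻¹ with hΓd
  set V := volume.real (Metric.ball (0 : EuclideanSpace ℝ (Fin m)) 1) with hVd
  refine ⟨(ENNReal.ofReal C * K0).toReal / (V * (Γ / 2)), ?_⟩
  intro N hN
  have hN0 : 0 < N := by linarith
  have hLB := LB_pos n k hN0
  set s := Γ * (LB n k N / 2) with hs
  have hs0 : 0 < s := by positivity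
  have hA : muG a (RegA m i N) ≤ ENNReal.ofReal C * K0 / ENNReal.ofReal s := by
    refine fatou_sets _ _ (fun j => Tsc n m (epsj j)⁻¹ (inv_pos.2 (epsj_pos j)).ne' ⁻¹'
      {x : Ep n m | s < ‖rieszPd1 a i k (ftest g h (epsj j)) x‖}) ?_ _ ?_
    · rintro ⟨x, ξ⟩ ⟨⟨⟨hx1, hx2⟩, hx3⟩, hξ⟩
      simp only at hx1 hx2 hx3 hξ
      have hξ' : ‖ξ‖ < 1 := by simpa using hξ
      have hx4 : 4 ≤ x i := by nlinarith
      have hlim := (riesz_limit hn hm i (by omega : 1 ≤ k) g hgc hgs hg h x hx4 ξ).norm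
      have hlow := J_lower i (by omega : 2 ≤ k) g hgc hgs hg hg0 hg1 x hN
        (fun j hj => (hx3 j hj).le) hx1.le hx2.le
      rw [hh1 ξ hξ'.le, one_mul, norm_mul, Complex.norm_real, Complex.norm_real,
        Real.norm_of_nonneg hΓ.le, Real.norm_eq_abs] at hlim
      have hlt : s < Γ * |∫ t in Ioi (0 : ℝ), t ^ ((k : ℝ) / 2 - 1) *
          ∫ y, g y * glim i k t x y| := by
        refine lt_of_lt_of_le ?_ (mul_le_mul_of_nonneg_left hlow hΓ.le)
        rw [hs]
        refine mul_lt_mul_of_pos_left ?_ hΓ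
        change LB n k N / 2 < LB n k N
        linarith
      exact hlim.eventually_const_lt hlt
    · intro j
      exact scaled_bound a g h (epsj_pos j) _ _ _ (hC _ (ftest_contDiff g hgd h _)
        (ftest_supp g hg h hh (epsj_pos j)) s hs0)
  have hB := (RegA_lower m i hN0).trans hA
  have hCK : ENNReal.ofReal C * K0 ≠ ⊤ := ENNReal.mul_ne_top ENNReal.ofReal_ne_top hfin.ne
  rw [ENNReal.le_div_iff_mul_le (Or.inl (by simpa using hs0)) (Or.inl ENNReal.ofReal_ne_top)] at hB
  have hR := ENNReal.toReal_mono hCK hB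
  rw [ENNReal.toReal_mul, ENNReal.toReal_mul, ENNReal.toReal_mul, ENNReal.toReal_ofReal (exp_pos _).le,
    ENNReal.toReal_ofReal (by positivity), ENNReal.toReal_ofReal hs0.le] at hR
  rw [le_div_iff₀ (by positivity)]
  refine le_trans (le_of_eq ?_) hR
  rw [hs, hVd, Measure.real]
  ring

/-- **Theorem**: for every `k ≥ 3`, the Riesz transform `R_{α,e₁} = ∂^k_{x'_1} G_{e₁}^{-k/2}`
(with `α = (k,0,…,0)`) is **not** of weak type `(1,1)` with respect to `dμ_{e₁}`. -/
theorem grushinRiesz_not_weak11 (n m : ℕ) (hn : 0 < n) (hm : 1 ≤ m)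
    (k : ℕ) (hk : 3 ≤ k) :
    ¬ ∃ C : ℝ,
        ∀ f : Ep n m → ℂ, ContDiff ℝ (⊤ : ℕ∞) f → HasCompactSupport f →
          ∀ s : ℝ, 0 < s →
            muG (EuclideanSpace.single (⟨0, hn⟩ : Fin n) 1)
                {x : Ep n m |
                  s < ‖rieszPd1 (EuclideanSpace.single (⟨0, hn⟩ : Fin n) 1) ⟨0, hn⟩ k f x‖} ≤
              ENNReal.ofReal C *
                eLpNorm f 1 (muG (EuclideanSpace.single (⟨0, hn⟩ : Fin n) 1)) /
                  ENNReal.ofReal s := by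
  rintro ⟨C, hC⟩
  obtain ⟨K, hK⟩ := key_ineq n m hn hm k hk ⟨0, hn⟩ C hC
  obtain ⟨c, hc, hg⟩ := LB_growth n hn hk
  have hk0 : (0 : ℝ) ≤ k := by positivity
  set N : ℝ := max ((k : ℝ) + 2) ((K + 1) / c) with hN
  have h1 : (k : ℝ) + 2 ≤ N := le_max_left _ _
  have h2 : (K + 1) / c ≤ N := le_max_right _ _
  have h3 := (hg N (by linarith)).trans (hK N h1)
  rw [div_le_iff₀ hc] at h2
  linarith
end
end

section
/- Let n ≥ 2, m ≥ 1, x ∈ ℝ^{n+m}, r > 1, and 1/4 ≤ h ≤ 1/2, and suppose |x'| > r. Then the set Ẽ = {y ∈ ℝ^{n+m} : |x'_⊥ − y'_⊥|² < r/16, |x''−y''| < |x'|/16, and y'_1 − x'_1 = r − h} is contained in E_h^1; in particular every y ∈ Ẽ satisfies d(x,y) < r and |x''−y''|^{1/2} ≤ |x'|+|y'|. -/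
noncomputable section
open MeasureTheory Real Set

/-- The Grushin quasi-distance `d(x,y)`. -/
def grushinDist {n m : ℕ} (x y : Ep n m) : ℝ :=
  ‖x.1 - y.1‖ +
    if Real.sqrt ‖x.2 - y.2‖ ≤ ‖x.1‖ + ‖y.1‖ then ‖x.2 - y.2‖ / (‖x.1‖ + ‖y.1‖)
    else Real.sqrt ‖x.2 - y.2‖

/-- **Theorem**: with first-coordinate dimension `n+1 ≥ 2`, `r > 1`, `1/4 ≤ h ≤ 1/2` and
`|x'| > r`, the set `Ẽ = {y : |x'_⊥ - y'_⊥|² < r/16, |x''-y''| < |x'|/16, y'_1 - x'_1 = r-h}`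
is contained in `E_h^1`: every such `y` satisfies `d(x,y) < r` (so `y ∈ B(x,r)`) and
`√|x''-y''| ≤ |x'| + |y'|`. -/
theorem tildeE_subset_Eh1_of_norm_gt (n m : ℕ) (hn : 1 ≤ n) (hm : 1 ≤ m)
    (x : Ep (n + 1) m) (r h : ℝ) (hr : 1 < r) (h1 : 1 / 4 ≤ h) (h2 : h ≤ 1 / 2)
    (hx : r < ‖x.1‖) :
    ∀ y : Ep (n + 1) m,
      (∑ i : Fin n, (x.1 i.succ - y.1 i.succ) ^ 2) < r / 16 →
      ‖x.2 - y.2‖ < ‖x.1‖ / 16 →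
      y.1 0 - x.1 0 = r - h →
      grushinDist x y < r ∧ Real.sqrt ‖x.2 - y.2‖ ≤ ‖x.1‖ + ‖y.1‖ := by
  intro y hp hd h0
  have hy : 0 ≤ ‖y.1‖ := norm_nonneg _
  have hd0 : 0 ≤ ‖x.2 - y.2‖ := norm_nonneg _
  have hs : Real.sqrt ‖x.2 - y.2‖ ≤ ‖x.1‖ + ‖y.1‖ := by
    apply Real.sqrt_le_iff.mpr
    constructor
    · linarith
    · nlinarith
  refine ⟨?_, hs⟩
  have hq : ‖x.2 - y.2‖ / (‖x.1‖ + ‖y.1‖) < 1 / 16 := by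
    rw [div_lt_iff₀ (by linarith)]
    linarith
  have hsq : ‖x.1 - y.1‖ ^ 2 = (r - h) ^ 2 + ∑ i : Fin n, (x.1 i.succ - y.1 i.succ) ^ 2 := by
    rw [EuclideanSpace.real_norm_sq_eq, Fin.sum_univ_succ, ← h0]
    simp only [PiLp.sub_apply]
    ring
  have hn1 : ‖x.1 - y.1‖ < r - 1 / 16 := by
    apply lt_of_pow_lt_pow_left₀ 2 (by linarith)
    rw [hsq]
    nlinarith [mul_nonneg (sub_nonneg.mpr hr.le) (sub_nonneg.mpr h1)]
  unfold grushinDist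
  rw [if_pos hs]
  linarith
end
end

section
/- Let n ≥ 2, m ≥ 1, x ∈ ℝ^{n+m}, r > 1, and 1/4 ≤ h ≤ 1/2, and suppose |x'| ≤ r. Then the set Ẽ = {y ∈ ℝ^{n+m} : |x'_⊥ − y'_⊥|² < r/16, |x''−y''| < r/16, and y'_1 − x'_1 = r − h} is contained in E_h^1; in particular every y ∈ Ẽ satisfies d(x,y) < r and |x''−y''|^{1/2} ≤ |x'|+|y'|. -/
noncomputable section
open MeasureTheory Real Set

/-- **Theorem**: with first-coordinate dimension `n+1 ≥ 2`, `r > 1`, `1/4 ≤ h ≤ 1/2` and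
`|x'| ≤ r`, the set `Ẽ = {y : |x'_⊥ - y'_⊥|² < r/16, |x''-y''| < r/16, y'_1 - x'_1 = r-h}`
is contained in `E_h^1`: every such `y` satisfies `d(x,y) < r` (so `y ∈ B(x,r)`) and
`√|x''-y''| ≤ |x'| + |y'|`. -/
theorem tildeE_subset_Eh1_of_norm_le (n m : ℕ) (hn : 1 ≤ n) (hm : 1 ≤ m)
    (x : Ep (n + 1) m) (r h : ℝ) (hr : 1 < r) (h1 : 1 / 4 ≤ h) (h2 : h ≤ 1 / 2)
    (hx : ‖x.1‖ ≤ r) :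
    ∀ y : Ep (n + 1) m,
      (∑ i : Fin n, (x.1 i.succ - y.1 i.succ) ^ 2) < r / 16 →
      ‖x.2 - y.2‖ < r / 16 →
      y.1 0 - x.1 0 = r - h →
      grushinDist x y < r ∧ Real.sqrt ‖x.2 - y.2‖ ≤ ‖x.1‖ + ‖y.1‖ := by
  intro y hs ht h0
  have hD : ‖x.1 - y.1‖ ^ 2 = (r - h) ^ 2 + ∑ i : Fin n, (x.1 i.succ - y.1 i.succ) ^ 2 := by
    rw [EuclideanSpace.real_norm_sq_eq, Fin.sum_univ_succ, ← h0]
    simp only [PiLp.sub_apply]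
    ring
  have hs0 : 0 ≤ ∑ i : Fin n, (x.1 i.succ - y.1 i.succ) ^ 2 :=
    Finset.sum_nonneg fun i _ => sq_nonneg _
  have hDlow : r - h ≤ ‖x.1 - y.1‖ := by
    apply le_of_not_gt
    intro hlt
    nlinarith [norm_nonneg (x.1 - y.1)]
  have hS : ‖x.1 - y.1‖ ≤ ‖x.1‖ + ‖y.1‖ := norm_sub_le _ _
  have hS2 : r / 2 ≤ ‖x.1‖ + ‖y.1‖ := by linarith
  have hDup : ‖x.1 - y.1‖ < r - 1 / 8 := by
    apply lt_of_pow_lt_pow_left₀ 2 (by linarith)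
    nlinarith
  have hsq : Real.sqrt ‖x.2 - y.2‖ ≤ ‖x.1‖ + ‖y.1‖ := by
    apply Real.sqrt_le_iff.mpr
    constructor
    · linarith
    · nlinarith
  refine ⟨?_, hsq⟩
  unfold grushinDist
  rw [if_pos hsq]
  have : ‖x.2 - y.2‖ / (‖x.1‖ + ‖y.1‖) ≤ 1 / 8 := by
    rw [div_le_iff₀ (by linarith)]
    linarith
  linarith
end
end
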